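/- Let k be a field, Γ a finite simple graph on {1,…,n} with clique complex K, and f : [n] → [m] a surjective function, with h_j = Σ_{i : f(i)=j} e_i ∈ E for 1 ≤ j ≤ m. Then the total group homology ⊕_{q≥0} H_q(G_Γ; k[ℤ^m]) is finite-dimensional over k if and only if h_1, h_2, …, h_m is a k⟨K⟩-regular sequence; here an element a ∈ E_1 is called M-regular for a graded E-module M if the complex (M, multiplication by a) is exact, i.e. the kernel of multiplication by a on M equals its image, and a sequence h_1,…,h_m is M-regular if h_1 is M-regular and h_i is M/(h_1,…,h_{i−1})M-regular for each 2 ≤ i ≤ m. -/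

import Mathlib

attribute [local instance] Classical.propDecidable

noncomputable section

open DirectSum

/-! ### Right-angled Artin groups -/

/-- The defining relators of a right-angled Artin group. -/
def raagRels {n : ℕ} (G : SimpleGraph (Fin n)) : Set (FreeGroup (Fin n)) :=
  {r | ∃ i j : Fin n, G.Adj i j ∧
    r = FreeGroup.of i * FreeGroup.of j * (FreeGroup.of i)⁻¹ * (FreeGroup.of j)⁻¹}

/-- The right-angled Artin group of a finite simple graph on `Fin n`. -/
abbrev RAAG {n : ℕ} (G : SimpleGraph (Fin n)) : Type :=
  PresentedGroup (raagRels G)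

/-- The clique complex of a graph. -/
def cliqueComplex {n : ℕ} (Γ : SimpleGraph (Fin n)) : Set (Finset (Fin n)) :=
  {σ | ∀ i ∈ σ, ∀ j ∈ σ, i ≠ j → Γ.Adj i j}

/-! ### Group homology with coefficients in `k[ℤᵐ]` -/

/-- The group algebra `k[ℤᵐ]` of Laurent polynomials. -/
abbrev LaurentRing (k : Type) [CommRing k] (m : ℕ) : Type :=
  AddMonoidAlgebra k (Fin m → ℤ)

/-- Multiplication by the monomial `y^v` on the Laurent ring. -/
def yMul (k : Type) [CommRing k] (m : ℕ) (v : Fin m → ℤ) :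
    LaurentRing k m →ₗ[LaurentRing k m] LaurentRing k m :=
  LinearMap.mulLeft (LaurentRing k m) (AddMonoidAlgebra.single v 1)

/-- The space of inhomogeneous `q`-chains of `G` with coefficients in the
Laurent ring. -/
abbrev inhomogChains (k : Type) [CommRing k] (m : ℕ) (G : Type) (q : ℕ) : Type :=
  (Fin q → G) →₀ LaurentRing k m

variable (k : Type) [Field k] {m : ℕ} {G : Type} [Group G]
  (φ : G →* Multiplicative (Fin m → ℤ))

/-- The differential of the inhomogeneous chain complex computing group
homology, where `g ∈ G` acts on the Laurent ring by multiplication by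
`y^{φ g}`. -/
def inhomogD (q : ℕ) :
    inhomogChains k m G (q + 1) →ₗ[LaurentRing k m] inhomogChains k m G q :=
  Finsupp.lsum ℕ fun g : Fin (q + 1) → G =>
    (Finsupp.lsingle (fun i => g i.succ)).comp
        (yMul k m (-(Multiplicative.toAdd (φ (g 0))))) +
    ∑ j : Fin (q + 1),
      ((-1 : ℤ) ^ ((j : ℕ) + 1)) • Finsupp.lsingle (Fin.contractNth j (· * ·) g)

/-- The differential entering degree `q` (zero for `q = 0`). -/
def inhomogDpre : ∀ q : ℕ,
    inhomogChains k m G q →ₗ[LaurentRing k m] inhomogChains k m G (q - 1)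
  | 0 => 0
  | (q + 1) => inhomogD k φ q

/-- The group homology `H_q(G; k[ℤᵐ])`. -/
def groupHomologyLaurent (q : ℕ) : Type :=
  ↥(Submodule.map (LinearMap.range (inhomogD k φ q)).mkQ
      (LinearMap.ker (inhomogDpre k φ q)))

instance (q : ℕ) : AddCommGroup (groupHomologyLaurent k φ q) :=
  inferInstanceAs (AddCommGroup ↥(Submodule.map _ _))

instance (q : ℕ) : Module (LaurentRing k m) (groupHomologyLaurent k φ q) :=
  inferInstanceAs (Module _ ↥(Submodule.map _ _))

/-- The `k`-module structure on group homology, by restriction of scalars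
along `k → k[ℤᵐ]`. -/
instance (q : ℕ) : Module k (groupHomologyLaurent k φ q) :=
  Module.compHom _ (algebraMap k (LaurentRing k m))

/-! ### The exterior Stanley–Reisner ring and regular sequences -/

/-- The exterior monomial `e_σ` in `Λ_k(e₁,…,eₙ)`. -/
def extMonomial (k : Type) [Field k] {n : ℕ} (σ : Finset (Fin n)) :
    ExteriorAlgebra k (Fin n → k) :=
  ((σ.sort (· ≤ ·)).map fun i => ExteriorAlgebra.ι k (Pi.single i 1)).prod

/-- The exterior Stanley–Reisner ideal `J_K` of a simplicial complex `K`. -/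
def extSRIdeal (k : Type) [Field k] {n : ℕ} (K : Set (Finset (Fin n))) :
    Ideal (ExteriorAlgebra k (Fin n → k)) :=
  Ideal.span {x | ∃ σ : Finset (Fin n), σ ∉ K ∧ x = extMonomial k σ}

/-- The element `h_j = ∑_{i : f i = j} eᵢ` of the exterior algebra. -/
def hGen (k : Type) [Field k] {n m : ℕ} (f : Fin n → Fin m) (j : Fin m) :
    ExteriorAlgebra k (Fin n → k) :=
  ∑ i ∈ Finset.univ.filter (fun i => f i = j), ExteriorAlgebra.ι k (Pi.single i 1)

/-- The quotient of the exterior Stanley–Reisner ring `k⟨K⟩ = E/J_K` by the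
submodule generated by `h_1 M ∪ ⋯ ∪ h_{i-1} M`, i.e. `M/(h₁,…,h_{i-1})M`. -/
def srQuot (k : Type) [Field k] {n m : ℕ} (K : Set (Finset (Fin n)))
    (f : Fin n → Fin m) (i : Fin m) : Type :=
  (ExteriorAlgebra k (Fin n → k) ⧸ extSRIdeal k K) ⧸
    Submodule.span (ExteriorAlgebra k (Fin n → k))
      {x : ExteriorAlgebra k (Fin n → k) ⧸ extSRIdeal k K |
        ∃ j : Fin m, j < i ∧ ∃ y, x = hGen k f j • y}

instance (k : Type) [Field k] {n m : ℕ} (K : Set (Finset (Fin n)))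
    (f : Fin n → Fin m) (i : Fin m) : AddCommGroup (srQuot k K f i) :=
  inferInstanceAs (AddCommGroup (_ ⧸ _))

instance (k : Type) [Field k] {n m : ℕ} (K : Set (Finset (Fin n)))
    (f : Fin n → Fin m) (i : Fin m) :
    Module (ExteriorAlgebra k (Fin n → k)) (srQuot k K f i) :=
  inferInstanceAs (Module _ (_ ⧸ _))

section Koszul

variable {k} {n : ℕ}

/-- The sign with which `e_i` is moved past the smaller indices of `σ`. -/
def koszulSign (i : Fin n) (σ : Finset (Fin n)) : ℤ :=
  (-1) ^ (σ.filter (· < i)).card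

lemma koszulSign_insert_of_lt {i j : Fin n} (h : i < j) (σ : Finset (Fin n)) :
    koszulSign i (insert j σ) = koszulSign i σ := by
  simp [koszulSign, Finset.filter_insert, h.not_gt]

lemma koszulSign_insert_of_gt {i j : Fin n} {σ : Finset (Fin n)} (h : j < i) (hj : j ∉ σ) :
    koszulSign i (insert j σ) = -koszulSign i σ := by
  simp [koszulSign, Finset.filter_insert, h, hj, pow_succ]

lemma koszulSign_of_forall_ge {i : Fin n} {σ : Finset (Fin n)} (h : ∀ j ∈ σ, i ≤ j) :
    koszulSign i σ = 1 := by
  have : σ.filter (· < i) = ∅ := Finset.filter_eq_empty_iff.2 fun j hj => (h j hj).not_gt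
  simp [koszulSign, this]

lemma koszulSign_swap {i j : Fin n} {σ : Finset (Fin n)} (hij : i ≠ j) (hi : i ∉ σ)
    (hj : j ∉ σ) :
    koszulSign i σ * koszulSign j (insert i σ) = -(koszulSign j σ * koszulSign i (insert j σ)) := by
  rcases lt_or_gt_of_ne hij with h | h
  · rw [koszulSign_insert_of_gt h hi, koszulSign_insert_of_lt h]; ring
  · rw [koszulSign_insert_of_gt h hj, koszulSign_insert_of_lt h]; ring

variable {R A : Type*} [CommRing R] [AddCommGroup A] [Module R A]

/-- The Koszul-type differential `(dz)(τ) = ∑_{i ∉ τ} ± X_i z(τ ∪ i)` attached to a family of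
operators `X_i`. -/
def koszulD (X : Fin n → A →ₗ[R] A) :
    (Finset (Fin n) → A) →ₗ[R] (Finset (Fin n) → A) :=
  LinearMap.pi fun τ => ∑ i, if i ∈ τ then 0 else
    koszulSign i τ • (X i ∘ₗ LinearMap.proj (insert i τ))

lemma koszulD_apply (X : Fin n → A →ₗ[R] A) (z : Finset (Fin n) → A) (τ : Finset (Fin n)) :
    koszulD X z τ = ∑ i, if i ∈ τ then 0 else koszulSign i τ • X i (z (insert i τ)) := by
  simp only [koszulD, LinearMap.pi_apply, LinearMap.sum_apply]
  refine Finset.sum_congr rfl fun i _ => ?_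
  split_ifs <;> simp

lemma koszulD_koszulD {K : Set (Finset (Fin n))} {X : Fin n → A →ₗ[R] A}
    (hX : ∀ i j, i ≠ j → ({i, j} : Finset (Fin n)) ∈ K → ∀ a, X i (X j a) = X j (X i a))
    (hK : ∀ σ ∈ K, ∀ τ ⊆ σ, τ ∈ K) {z : Finset (Fin n) → A} (hz : ∀ σ ∉ K, z σ = 0) :
    koszulD X (koszulD X z) = 0 := by
  funext τ
  have key : koszulD X (koszulD X z) τ = ∑ p : Fin n × Fin n,
      if p.1 ∈ τ ∨ p.2 ∈ insert p.1 τ then 0 else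
        (koszulSign p.1 τ * koszulSign p.2 (insert p.1 τ)) •
          X p.1 (X p.2 (z (insert p.2 (insert p.1 τ)))) := by
    rw [koszulD_apply, Fintype.sum_prod_type]
    refine Finset.sum_congr rfl fun i _ => ?_
    by_cases hi : i ∈ τ
    · simp [hi]
    · simp only [hi, if_false, false_or, koszulD_apply, map_sum, Finset.smul_sum]
      refine Finset.sum_congr rfl fun j _ => ?_
      split_ifs
      · simp
      · rw [map_zsmul, smul_smul]
  rw [key]
  refine Finset.sum_involution (fun p _ => (p.2, p.1)) ?_ ?_ (fun _ _ => Finset.mem_univ _)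
    (fun _ _ => rfl)
  · rintro ⟨i, j⟩ -
    by_cases hi : i ∈ τ
    · simp [hi]
    by_cases hj : j ∈ τ
    · simp [hj]
    by_cases hij : i = j
    · simp [hij]
    have hji : ¬ j = i := fun h => hij h.symm
    simp only [hi, hj, hij, hji, Finset.mem_insert, or_self, if_false]
    rw [koszulSign_swap hij hi hj, Finset.insert_comm j i]
    by_cases hm : insert i (insert j τ) ∈ K
    · rw [hX i j hij (hK _ hm _ (by intro x; simp; tauto))]
      simp
    · simp [hz _ hm]
  · rintro ⟨i, j⟩ - h heq
    have : j = i := by simpa using congrArg Prod.fst heq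
    subst this
    simp at h

lemma koszulD_eq_zero_of_notMem {K : Set (Finset (Fin n))} {X : Fin n → A →ₗ[R] A}
    (hK : ∀ σ ∈ K, ∀ τ ⊆ σ, τ ∈ K) {z : Finset (Fin n) → A} (hz : ∀ σ ∉ K, z σ = 0)
    {τ : Finset (Fin n)} (hτ : τ ∉ K) : koszulD X z τ = 0 := by
  rw [koszulD_apply]
  refine Finset.sum_eq_zero fun i _ => ?_
  rw [hz _ fun h => hτ (hK _ h _ (Finset.subset_insert i τ))]
  simp

end Koszul

section KoszulExact

variable {k} {n : ℕ} {R A : Type*} [CommRing R] [AddCommGroup A] [Module R A]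

lemma cliqueComplex_mono {Γ : SimpleGraph (Fin n)} :
    ∀ σ ∈ cliqueComplex Γ, ∀ τ ⊆ σ, τ ∈ cliqueComplex Γ :=
  fun _ hσ _ hτ i hi j hj hij => hσ i (hτ hi) j (hτ hj) hij

lemma insert_mem_cliqueComplex_iff {Γ : SimpleGraph (Fin n)} {v : Fin n} {σ : Finset (Fin n)}
    (hv : v ∉ σ) : insert v σ ∈ cliqueComplex Γ ↔
      σ ∈ cliqueComplex Γ ∧ ∀ u ∈ σ, Γ.Adj u v := by
  constructor
  · intro h
    refine ⟨cliqueComplex_mono _ h _ (Finset.subset_insert _ _), fun u hu => ?_⟩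
    exact h u (by simp [hu]) v (by simp) (by rintro rfl; exact hv hu)
  · rintro ⟨h, h'⟩ i hi j hj hij
    rw [Finset.mem_insert] at hi hj
    rcases hi with rfl | hi <;> rcases hj with rfl | hj
    · exact (hij rfl).elim
    · exact (h' j hj).symm
    · exact h' i hi
    · exact h i hi j hj hij

theorem koszulD_exact {Γ : SimpleGraph (Fin n)} {X : Fin n → A →ₗ[R] A}
    (hX : ∀ i j, Γ.Adj i j → ∀ a, X i (X j a) = X j (X i a))
    (hInj : ∀ (v : Fin n) (S : Finset (Fin n)), (∀ u ∈ S, u < v) → ∀ (a : A) (b : Fin n → A),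
      X v a = ∑ u ∈ S, X u (b u) →
        ∃ b' : Fin n → A, a = ∑ u ∈ S.filter (Γ.Adj · v), X u (b' u))
    (S : Finset (Fin n)) : ∀ z : Finset (Fin n) → A,
      (∀ σ, ¬ (σ ∈ cliqueComplex Γ ∧ σ ⊆ S) → z σ = 0) → koszulD X z = 0 →
      (∃ b : Fin n → A, z ∅ = ∑ u ∈ S, X u (b u)) →
      ∃ w : Finset (Fin n) → A, (∀ σ, ¬ (σ ∈ cliqueComplex Γ ∧ σ ⊆ S) → w σ = 0) ∧
        koszulD X w = z := by
  induction S using Finset.strongInduction with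
  | H S ih =>
  intro z hz hdz hb
  obtain ⟨b, hb⟩ := hb
  rcases S.eq_empty_or_nonempty with rfl | hS
  · refine ⟨0, by simp, ?_⟩
    rw [map_zero]
    funext σ
    by_cases hσ : σ = ∅
    · subst hσ; simp [hb]
    · exact (hz σ fun h => hσ (Finset.subset_empty.1 h.2)).symm
  have hd : ∀ τ, ∑ i, (if i ∈ τ then 0 else koszulSign i τ • X i (z (insert i τ))) = 0 :=
    fun τ => by rw [← koszulD_apply, hdz]; rfl
  obtain ⟨v, hvS, hmax⟩ : ∃ v ∈ S, ∀ u ∈ S, u ≤ v :=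
    ⟨S.max' hS, S.max'_mem hS, fun u hu => S.le_max' u hu⟩
  set S' := S.erase v with hS'
  set L := S'.filter (Γ.Adj · v) with hL
  have hS'S : S' ⊂ S := Finset.erase_ssubset hvS
  have hLS' : L ⊆ S' := Finset.filter_subset _ _
  have hvS' : v ∉ S' := Finset.notMem_erase v S
  have hlt : ∀ u ∈ S', u < v := fun u hu =>
    lt_of_le_of_ne (hmax u (Finset.mem_of_mem_erase hu)) (Finset.ne_of_mem_erase hu)
  have hins : ∀ τ : Finset (Fin n), v ∉ τ →
      (¬ (τ ∈ cliqueComplex Γ ∧ τ ⊆ L) ↔ ¬ (insert v τ ∈ cliqueComplex Γ ∧ insert v τ ⊆ S)) := by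
    intro τ hv
    rw [insert_mem_cliqueComplex_iff hv, not_iff_not]
    constructor
    · rintro ⟨h1, h2⟩
      refine ⟨⟨h1, fun u hu => (Finset.mem_filter.1 (h2 hu)).2⟩, ?_⟩
      exact Finset.insert_subset hvS (h2.trans (hLS'.trans hS'S.subset))
    · rintro ⟨⟨h1, h2⟩, h3⟩
      refine ⟨h1, fun u hu => Finset.mem_filter.2 ⟨?_, h2 u hu⟩⟩
      exact Finset.mem_erase.2 ⟨by rintro rfl; exact hv hu, h3 (Finset.mem_insert_of_mem hu)⟩
  set z' : Finset (Fin n) → A := fun τ => if v ∈ τ then 0 else z (insert v τ) with hz'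
  have hz's : ∀ σ, ¬ (σ ∈ cliqueComplex Γ ∧ σ ⊆ L) → z' σ = 0 := by
    intro σ hσ
    by_cases hv : v ∈ σ
    · simp [hz', hv]
    · simp only [hz', hv, if_false]
      exact hz _ ((hins σ hv).1 hσ)
  have hcoef : ∀ (w : Finset (Fin n) → A) (τ : Finset (Fin n)), v ∉ τ →
      (∀ σ, ¬ (σ ∈ cliqueComplex Γ ∧ σ ⊆ S) → w σ = 0) →
      koszulD X (fun τ => if v ∈ τ then 0 else w (insert v τ)) τ = koszulD X w (insert v τ) := by
    intro w τ hv hw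
    rw [koszulD_apply, koszulD_apply]
    refine Finset.sum_congr rfl fun i _ => ?_
    by_cases hi : i ∈ τ
    · simp [hi]
    by_cases hiv : i = v
    · simp [hiv]
    have hvi : ¬ v = i := fun h => hiv h.symm
    simp only [hi, hiv, hvi, hv, Finset.mem_insert, or_self, if_false]
    rw [Finset.insert_comm]
    rcases lt_or_gt_of_ne hiv with h | h
    · rw [koszulSign_insert_of_lt h]
    · rw [hw (insert i (insert v τ)) fun hc => absurd (hmax i (hc.2 (by simp))) h.not_ge]
      simp
  have hdz' : koszulD X z' = 0 := by
    funext τ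
    by_cases hv : v ∈ τ
    · rw [koszulD_apply]
      refine Finset.sum_eq_zero fun i _ => ?_
      simp [hz', hv]
    · rw [hz', hcoef z τ hv hz, hdz]
      rfl
  have hz'b : ∃ b' : Fin n → A, z' ∅ = ∑ u ∈ L, X u (b' u) := by
    refine hInj v S' hlt (z' ∅) (fun u => - z {u}) ?_
    have h0 := hd ∅
    simp only [Finset.notMem_empty, if_false, insert_empty_eq] at h0
    have h1 : ∑ i, X i (z {i}) = 0 := by
      rw [← h0]
      refine Finset.sum_congr rfl fun i _ => ?_
      rw [koszulSign_of_forall_ge (by simp), one_smul]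
    rw [← Finset.sum_subset (Finset.subset_univ S), ← Finset.add_sum_erase S _ hvS] at h1
    · simp only [hz', Finset.notMem_empty, if_false, insert_empty_eq, map_neg,
        Finset.sum_neg_distrib]
      exact eq_neg_of_add_eq_zero_left h1
    · intro i _ hi
      rw [hz {i} fun h => hi (h.2 (by simp)), map_zero]
  obtain ⟨w, hw, hdw⟩ := ih L (lt_of_le_of_lt hLS' hS'S) z' hz's hdz' hz'b
  set W : Finset (Fin n) → A := fun σ =>
    if v ∈ σ then (if σ = {v} then b v else w (σ.erase v)) else 0 with hW
  have hWs : ∀ σ, ¬ (σ ∈ cliqueComplex Γ ∧ σ ⊆ S) → W σ = 0 := by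
    intro σ hσ
    by_cases hv : v ∈ σ
    · have hσv : σ ≠ {v} := by
        rintro rfl
        refine hσ ⟨?_, by simpa using hvS⟩
        intro i hi j hj hij
        simp at hi hj
        exact (hij (hi.trans hj.symm)).elim
      simp only [hW, hv, hσv, if_true, if_false]
      refine hw _ ((hins _ (Finset.notMem_erase _ _)).2 ?_)
      rwa [Finset.insert_erase hv]
    · simp [hW, hv]
  have hdWv : ∀ τ, v ∉ τ → koszulD X W (insert v τ) = z (insert v τ) := by
    intro τ hv
    rw [← hcoef W τ hv hWs]
    have h2 := congrFun hdw τ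
    simp only [hz', hv, if_false] at h2
    rw [← h2, koszulD_apply, koszulD_apply]
    refine Finset.sum_congr rfl fun i _ => ?_
    by_cases hi : i ∈ τ
    · simp [hi]
    by_cases hiv : v = i
    · subst hiv
      rw [hw (insert v τ) fun h => hvS' (hLS' (h.2 (by simp)))]
      simp
    · have hne : insert v (insert i τ) ≠ {v} := by
        intro h
        have : i ∈ ({v} : Finset (Fin n)) := by rw [← h]; simp
        exact hiv (Finset.mem_singleton.1 this).symm
      have hnm : v ∉ insert i τ := by simp [hv, hiv]
      simp only [hi, if_false, hnm]
      simp only [hW, Finset.mem_insert_self, if_true, hne, if_false, Finset.erase_insert hnm]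
  have hdW0 : koszulD X W ∅ = X v (b v) := by
    rw [koszulD_apply, Finset.sum_eq_single v]
    · simp [hW, koszulSign_of_forall_ge]
    · intro i _ hi
      simp [hW, hi.symm]
    · simp
  have hK : ∀ σ ∈ {σ | σ ∈ cliqueComplex Γ ∧ σ ⊆ S}, ∀ τ ⊆ σ,
      τ ∈ {σ | σ ∈ cliqueComplex Γ ∧ σ ⊆ S} :=
    fun σ hσ τ hτ => ⟨cliqueComplex_mono _ hσ.1 _ hτ, hτ.trans hσ.2⟩
  have hX' : ∀ i j, i ≠ j → ({i, j} : Finset (Fin n)) ∈ {σ | σ ∈ cliqueComplex Γ ∧ σ ⊆ S} →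
      ∀ a, X i (X j a) = X j (X i a) :=
    fun i j hij h => hX i j (h.1 i (by simp) j (by simp) hij)
  obtain ⟨w', hw', hdw'⟩ := ih S' hS'S (z - koszulD X W) (by
      intro σ hσ
      by_cases hv : v ∈ σ
      · have := hdWv (σ.erase v) (Finset.notMem_erase _ _)
        rw [Finset.insert_erase hv] at this
        simp [this]
      · have : ¬ (σ ∈ cliqueComplex Γ ∧ σ ⊆ S) := fun h =>
          hσ ⟨h.1, fun u hu => Finset.mem_erase.2 ⟨by rintro rfl; exact hv hu, h.2 hu⟩⟩
        rw [Pi.sub_apply, hz σ this, koszulD_eq_zero_of_notMem hK hWs this, sub_zero])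
    (by rw [map_sub, hdz, koszulD_koszulD hX' hK hWs, sub_zero])
    ⟨b, by rw [Pi.sub_apply, hdW0, hb, ← Finset.add_sum_erase S _ hvS]; simp [hS']⟩
  refine ⟨W + w', fun σ hσ => ?_, by rw [map_add, hdw']; abel⟩
  rw [Pi.add_apply, hWs σ hσ, hw' σ fun h => hσ ⟨h.1, h.2.trans hS'S.subset⟩, add_zero]

end KoszulExact

section GroupAlgebra

variable {k} {n : ℕ}

/-- A homomorphism out of a right-angled Artin group, given by the images of the generators. -/
def raagLift {H : Type*} [Group H] {Γ : SimpleGraph (Fin n)} (F : Fin n → H)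
    (hF : ∀ i j, Γ.Adj i j → F i * F j = F j * F i) : RAAG Γ →* H :=
  PresentedGroup.toGroup (f := F) (by
    rintro r ⟨i, j, hij, rfl⟩
    simp only [map_mul, map_inv, FreeGroup.lift_apply_of]
    rw [hF i j hij]; group)

@[simp]
lemma raagLift_of {H : Type*} [Group H] {Γ : SimpleGraph (Fin n)} (F : Fin n → H)
    (hF : ∀ i j, Γ.Adj i j → F i * F j = F j * F i) (i : Fin n) :
    raagLift F hF (PresentedGroup.of i) = F i :=
  PresentedGroup.toGroup.of _

lemma raag_of_comm {Γ : SimpleGraph (Fin n)} {i j : Fin n} (h : Γ.Adj i j) :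
    (PresentedGroup.of i : RAAG Γ) * PresentedGroup.of j =
      PresentedGroup.of j * PresentedGroup.of i := by
  have h1 : PresentedGroup.mk (raagRels Γ)
      (FreeGroup.of i * FreeGroup.of j * (FreeGroup.of i)⁻¹ * (FreeGroup.of j)⁻¹) = 1 :=
    PresentedGroup.mk_eq_one_iff.2 (Subgroup.subset_normalClosure ⟨i, j, h, rfl⟩)
  simp only [map_mul, map_inv] at h1
  rw [mul_inv_eq_one, mul_inv_eq_iff_eq_mul] at h1
  exact h1

variable (k) in
/-- The element `v_i - 1` of the group algebra of a right-angled Artin group. -/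
def genSub (Γ : SimpleGraph (Fin n)) (i : Fin n) : MonoidAlgebra k (RAAG Γ) :=
  MonoidAlgebra.of k _ (PresentedGroup.of i) - 1

lemma genSub_comm {Γ : SimpleGraph (Fin n)} {i j : Fin n} (h : Γ.Adj i j) :
    genSub k Γ i * genSub k Γ j = genSub k Γ j * genSub k Γ i := by
  have : MonoidAlgebra.of k (RAAG Γ) (PresentedGroup.of i) *
      MonoidAlgebra.of k _ (PresentedGroup.of j) = MonoidAlgebra.of k _ (PresentedGroup.of j) *
      MonoidAlgebra.of k _ (PresentedGroup.of i) := by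
    rw [← map_mul, ← map_mul, raag_of_comm h]
  simp only [genSub, sub_mul, mul_sub, this, one_mul, mul_one]
  abel

/-- Data of a crossed homomorphism relative to an endomorphism `ρ`. -/
lemma exists_fox_derivative {Γ : SimpleGraph (Fin n)} (v : Fin n) (S : Finset (Fin n))
    (hv : v ∉ S) {Q : Type*} [AddCommGroup Q] [DistribMulAction (RAAG Γ) Q] (x : Q)
    (hx : ∀ u ∈ S, Γ.Adj u v → (PresentedGroup.of u : RAAG Γ) • x = x) :
    ∃ s : RAAG Γ → Q, ∀ g, s (g * PresentedGroup.of v) = s g + g • x ∧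
      ∀ u ∈ S, s (g * PresentedGroup.of u) = s g := by
  let ρ : RAAG Γ →* RAAG Γ :=
    raagLift (fun u => if u ∈ insert v S then PresentedGroup.of u else 1) (by
      intro i j hij
      split_ifs <;> simp [raag_of_comm hij])
  have hρ : ∀ u ∈ insert v S, ρ (PresentedGroup.of u) = PresentedGroup.of u := fun u hu => by
    simp only [ρ, raagLift_of, if_pos hu]
  have hρ' : ∀ u ∉ insert v S, ρ (PresentedGroup.of u) = 1 := fun u hu => by
    simp only [ρ, raagLift_of, if_neg hu]
  let ψ : RAAG Γ →* MulAut (Multiplicative Q) := MulAutMultiplicative Q |>.symm.toMonoidHom.comp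
    (DistribMulAction.toAddAut (RAAG Γ) Q)
  have hψ : ∀ g q, (ψ g q).toAdd = g • q.toAdd := fun g q => rfl
  have hfix : ∀ u, Γ.Adj u v → ρ (PresentedGroup.of u) • x = x := by
    intro u huv
    by_cases hu : u ∈ insert v S
    · rw [hρ u hu]
      exact hx u ((Finset.mem_insert.1 hu).resolve_left huv.ne) huv
    · rw [hρ' u hu, one_smul]
  let α : RAAG Γ →* Multiplicative Q ⋊[ψ] RAAG Γ :=
    raagLift (fun u => ⟨Multiplicative.ofAdd (if u = v then x else 0), ρ (PresentedGroup.of u)⟩) (by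
      intro i j hij
      apply SemidirectProduct.ext
      · apply Multiplicative.toAdd.injective
        simp only [SemidirectProduct.mul_left, toAdd_mul, hψ, toAdd_ofAdd]
        by_cases hi : i = v
        · subst hi
          have hj : j ≠ i := hij.ne'
          simp [hj, hfix j hij.symm]
        · by_cases hj : j = v
          · subst hj
            simp [hi, hfix i hij]
          · simp [hi, hj]
      · simp only [SemidirectProduct.mul_right, ← map_mul, raag_of_comm hij])
  have hαr : ∀ g, (α g).right = ρ g := by
    have : SemidirectProduct.rightHom.comp α = ρ := by
      ext u; simp [α]
    intro g
    rw [← this]; rfl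
  have hαl : ∀ u, (α (PresentedGroup.of u)).left.toAdd = if u = v then x else 0 := by
    intro u; simp only [α, raagLift_of, toAdd_ofAdd]
  have key : ∀ g u, u ∈ insert v S →
      (g * PresentedGroup.of u * (ρ (g * PresentedGroup.of u))⁻¹) •
        (α (g * PresentedGroup.of u)).left.toAdd =
      (g * (ρ g)⁻¹) • (α g).left.toAdd + g • (if u = v then x else 0) := by
    intro g u hu
    rw [map_mul α, SemidirectProduct.mul_left, toAdd_mul, hψ, hαr, hαl, map_mul, hρ u hu,
      smul_add, smul_smul]
    congr 2 <;> group
  refine ⟨fun g => (g * (ρ g)⁻¹) • (α g).left.toAdd, fun g => ⟨?_, fun u hu => ?_⟩⟩ <;> beta_reduce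
  · rw [key g v (by simp), if_pos rfl]
  · have : u ≠ v := by rintro rfl; exact hv hu
    rw [key g u (by simp [hu]), if_neg this, smul_zero, add_zero]

theorem genSub_colon {Γ : SimpleGraph (Fin n)} (v : Fin n) (S : Finset (Fin n)) (hv : v ∉ S)
    (a : MonoidAlgebra k (RAAG Γ)) (b : Fin n → MonoidAlgebra k (RAAG Γ))
    (h : a * genSub k Γ v = ∑ u ∈ S, b u * genSub k Γ u) :
    ∃ b' : Fin n → MonoidAlgebra k (RAAG Γ),
      a = ∑ u ∈ S.filter (Γ.Adj · v), b' u * genSub k Γ u := by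
  set I : Ideal (MonoidAlgebra k (RAAG Γ)) :=
    Submodule.span _ (genSub k Γ '' ↑(S.filter (Γ.Adj · v))) with hI
  let Q := MonoidAlgebra k (RAAG Γ) ⧸ I
  let _ : DistribMulAction (RAAG Γ) Q :=
    DistribMulAction.compHom Q (MonoidAlgebra.of k (RAAG Γ))
  have hsm : ∀ (g : RAAG Γ) (q : Q), g • q = MonoidAlgebra.of k _ g • q := fun _ _ => rfl
  obtain ⟨s, hs⟩ := exists_fox_derivative v S hv (I.mkQ 1 : Q) (by
    intro u hu huv
    rw [hsm, ← map_smul, ← sub_eq_zero, ← map_sub, Submodule.mkQ_apply,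
      Submodule.Quotient.mk_eq_zero, smul_eq_mul, mul_one]
    exact Submodule.subset_span ⟨u, by simp [hu, huv], rfl⟩)
  let T : MonoidAlgebra k (RAAG Γ) →ₗ[k] Q :=
    Finsupp.lsum k (fun g => LinearMap.toSpanSingleton k Q (s g)) ∘ₗ
      (MonoidAlgebra.coeffLinearEquiv k).toLinearMap
  have hT : ∀ g r, T (MonoidAlgebra.single g r) = r • s g := by
    intro g r
    simp [T]
  have hTv : ∀ a, T (a * genSub k Γ v) = I.mkQ a := by
    intro a
    induction a using MonoidAlgebra.induction_linear with
    | zero => simp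
    | add f g hf hg => rw [add_mul, map_add, hf, hg, map_add]
    | single g r =>
      rw [genSub, mul_sub, mul_one, MonoidAlgebra.of_apply, MonoidAlgebra.single_mul_single,
        mul_one, map_sub, hT, hT, (hs g).1, smul_add, add_sub_cancel_left, hsm, ← map_smul,
        smul_eq_mul, mul_one, MonoidAlgebra.of_apply]
      have : MonoidAlgebra.single g r = r • MonoidAlgebra.single g (1 : k) := by simp
      rw [this]
      rfl
  have hTu : ∀ u ∈ S, ∀ a, T (a * genSub k Γ u) = 0 := by
    intro u hu a
    induction a using MonoidAlgebra.induction_linear with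
    | zero => simp
    | add f g hf hg => rw [add_mul, map_add, hf, hg, add_zero]
    | single g r =>
      rw [genSub, mul_sub, mul_one, MonoidAlgebra.of_apply, MonoidAlgebra.single_mul_single,
        mul_one, map_sub, hT, hT, (hs g).2 u hu, sub_self]
  have ha : a ∈ I := by
    rw [← Submodule.Quotient.mk_eq_zero, ← Submodule.mkQ_apply, ← hTv, h, map_sum]
    exact Finset.sum_eq_zero fun u hu => hTu u hu _
  obtain ⟨c, hc⟩ := Submodule.mem_span_image_finset_iff_exists_fun' _ |>.1 ha
  exact ⟨c, hc.symm⟩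

theorem mem_augmentation_iff {Γ : SimpleGraph (Fin n)} (a : MonoidAlgebra k (RAAG Γ))
    (ha : MonoidAlgebra.lift k k (RAAG Γ) 1 a = 0) :
    ∃ b : Fin n → MonoidAlgebra k (RAAG Γ), a = ∑ u, b u * genSub k Γ u := by
  set I : Ideal (MonoidAlgebra k (RAAG Γ)) :=
    Submodule.span _ (genSub k Γ '' ↑(Finset.univ : Finset (Fin n))) with hI
  have hgen : ∀ g h : RAAG Γ, MonoidAlgebra.of k _ (h * g) - MonoidAlgebra.of k _ h ∈ I := by
    intro g
    obtain ⟨w, rfl⟩ : ∃ w, g = PresentedGroup.mk _ w :=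
      (QuotientGroup.mk_surjective g).imp fun _ h => h.symm
    induction w using FreeGroup.induction_on with
    | C1 => simp
    | of i =>
      intro h
      have : MonoidAlgebra.of k _ (h * PresentedGroup.of i) - MonoidAlgebra.of k _ h =
          MonoidAlgebra.of k _ h • genSub k Γ i := by
        rw [smul_eq_mul, genSub, mul_sub, mul_one, map_mul]
      exact this ▸ I.smul_mem _ (Submodule.subset_span ⟨i, by simp, rfl⟩)
    | inv_of i ih =>
      intro h
      have := ih (h * (PresentedGroup.mk _ (FreeGroup.of i))⁻¹)
      rw [inv_mul_cancel_right] at this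
      rw [map_inv, ← neg_sub]
      exact I.neg_mem this
    | mul x y hx hy =>
      intro h
      have := I.add_mem (hy (h * PresentedGroup.mk _ x)) (hx h)
      rw [sub_add_sub_cancel] at this
      rwa [map_mul (PresentedGroup.mk _), ← mul_assoc]
  have hsub : ∀ a : MonoidAlgebra k (RAAG Γ),
      a - algebraMap k _ (MonoidAlgebra.lift k k (RAAG Γ) 1 a) ∈ I := by
    intro a
    induction a using MonoidAlgebra.induction_linear with
    | zero => simp
    | add f g hf hg =>
      rw [map_add, map_add, add_sub_add_comm]
      exact I.add_mem hf hg
    | single g r =>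
      have h1 := I.smul_of_tower_mem r (hgen g 1)
      convert h1 using 1
      simp [MonoidAlgebra.lift_single, smul_sub, Algebra.algebraMap_eq_smul_one,
        MonoidAlgebra.one_def]
  have h := hsub a
  rw [ha, map_zero, sub_zero] at h
  obtain ⟨c, hc⟩ := Submodule.mem_span_image_finset_iff_exists_fun' _ |>.1 h
  exact ⟨c, hc.symm⟩

end GroupAlgebra

section FinsuppKoszul

variable {k} {n : ℕ} {R A A' : Type*} [CommRing R] [AddCommGroup A] [Module R A]
  [AddCommGroup A'] [Module R A']

/-- The cliques with `q` vertices. -/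
abbrev Clq (Γ : SimpleGraph (Fin n)) (q : ℕ) : Type :=
  {σ : Finset (Fin n) // σ ∈ cliqueComplex Γ ∧ σ.card = q}

variable (R A) in
/-- Extension by zero of a function on the cliques of size `q`. -/
def clqExt (Γ : SimpleGraph (Fin n)) (q : ℕ) :
    (Clq Γ q →₀ A) →ₗ[R] (Finset (Fin n) → A) :=
  LinearMap.pi fun σ => if h : σ ∈ cliqueComplex Γ ∧ σ.card = q then
    Finsupp.lapply ⟨σ, h⟩ else 0

variable (R A) in
/-- Restriction of a function to the cliques of size `q`. -/
def clqRes (Γ : SimpleGraph (Fin n)) (q : ℕ) :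
    (Finset (Fin n) → A) →ₗ[R] (Clq Γ q →₀ A) :=
  (Finsupp.linearEquivFunOnFinite R A (Clq Γ q)).symm.toLinearMap ∘ₗ
    LinearMap.funLeft R A Subtype.val

lemma clqExt_of_mem {Γ : SimpleGraph (Fin n)} {q : ℕ} (z : Clq Γ q →₀ A) (σ : Clq Γ q) :
    clqExt R A Γ q z σ = z σ := by
  simp [clqExt, σ.2]

lemma clqExt_of_notMem {Γ : SimpleGraph (Fin n)} {q : ℕ} (z : Clq Γ q →₀ A) {σ : Finset (Fin n)}
    (h : ¬ (σ ∈ cliqueComplex Γ ∧ σ.card = q)) : clqExt R A Γ q z σ = 0 := by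
  simp [clqExt, h]

lemma clqRes_apply {Γ : SimpleGraph (Fin n)} {q : ℕ} (z : Finset (Fin n) → A) (σ : Clq Γ q) :
    clqRes R A Γ q z σ = z σ := by
  simp [clqRes, LinearMap.funLeft]

lemma clqExt_clqRes {Γ : SimpleGraph (Fin n)} {q : ℕ} (z : Finset (Fin n) → A)
    (hz : ∀ σ, ¬ (σ ∈ cliqueComplex Γ ∧ σ.card = q) → z σ = 0) :
    clqExt R A Γ q (clqRes R A Γ q z) = z := by
  funext σ
  by_cases h : σ ∈ cliqueComplex Γ ∧ σ.card = q
  · exact (clqExt_of_mem _ ⟨σ, h⟩).trans (clqRes_apply _ _)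
  · rw [clqExt_of_notMem _ h, hz σ h]

lemma clqExt_injective {Γ : SimpleGraph (Fin n)} {q : ℕ} :
    Function.Injective (clqExt R A Γ q) := by
  intro z w h
  ext σ
  rw [← clqExt_of_mem (R := R), h, clqExt_of_mem]

/-- The degree `q + 1` part of the Koszul differential on cliques. -/
def clqD (X : Fin n → A →ₗ[R] A) (Γ : SimpleGraph (Fin n)) (q : ℕ) :
    (Clq Γ (q + 1) →₀ A) →ₗ[R] (Clq Γ q →₀ A) :=
  clqRes R A Γ q ∘ₗ koszulD X ∘ₗ clqExt R A Γ (q + 1)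

lemma clqExt_clqD (X : Fin n → A →ₗ[R] A) (Γ : SimpleGraph (Fin n)) (q : ℕ)
    (z : Clq Γ (q + 1) →₀ A) :
    clqExt R A Γ q (clqD X Γ q z) = koszulD X (clqExt R A Γ (q + 1) z) := by
  refine clqExt_clqRes _ fun σ hσ => ?_
  rw [LinearMap.comp_apply, koszulD_apply]
  refine Finset.sum_eq_zero fun i _ => ?_
  split_ifs with hi
  · rfl
  · rw [clqExt_of_notMem, map_zero, smul_zero]
    rintro ⟨h, h'⟩
    refine hσ ⟨cliqueComplex_mono _ h _ (Finset.subset_insert _ _), ?_⟩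
    rw [Finset.card_insert_of_notMem hi] at h'
    omega

lemma clqD_clqD {X : Fin n → A →ₗ[R] A} {Γ : SimpleGraph (Fin n)}
    (hX : ∀ i j, Γ.Adj i j → ∀ a, X i (X j a) = X j (X i a)) (q : ℕ)
    (z : Clq Γ (q + 1 + 1) →₀ A) : clqD X Γ q (clqD X Γ (q + 1) z) = 0 := by
  apply clqExt_injective (R := R)
  rw [clqExt_clqD, clqExt_clqD, map_zero]
  refine koszulD_koszulD (K := cliqueComplex Γ) ?_ cliqueComplex_mono ?_
  · intro i j hij hK
    exact hX i j (hK i (by simp) j (by simp) hij)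
  · exact fun σ hσ => clqExt_of_notMem _ fun h => hσ h.1

lemma clqD_mapRange {X : Fin n → A →ₗ[R] A} {X' : Fin n → A' →ₗ[R] A'}
    (T : A →ₗ[R] A') (hT : ∀ i a, T (X i a) = X' i (T a)) (Γ : SimpleGraph (Fin n)) (q : ℕ)
    (z : Clq Γ (q + 1) →₀ A) :
    clqD X' Γ q (Finsupp.mapRange.linearMap T z) =
      Finsupp.mapRange.linearMap T (clqD X Γ q z) := by
  have h1 : ∀ (q) (w : Clq Γ q →₀ A) (σ), clqExt R A' Γ q (Finsupp.mapRange.linearMap T w) σ =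
      T (clqExt R A Γ q w σ) := by
    intro q w σ
    by_cases h : σ ∈ cliqueComplex Γ ∧ σ.card = q
    · exact (clqExt_of_mem _ ⟨σ, h⟩).trans (congrArg T (clqExt_of_mem w ⟨σ, h⟩).symm)
    · rw [clqExt_of_notMem _ h, clqExt_of_notMem _ h, map_zero]
  apply clqExt_injective (R := R)
  funext σ
  rw [h1, clqExt_clqD, clqExt_clqD, koszulD_apply, koszulD_apply, map_sum]
  refine Finset.sum_congr rfl fun i _ => ?_
  split_ifs
  · rw [map_zero]
  · rw [h1, map_zsmul, hT]

theorem clqD_exact {Γ : SimpleGraph (Fin n)} {X : Fin n → A →ₗ[R] A}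
    (hX : ∀ i j, Γ.Adj i j → ∀ a, X i (X j a) = X j (X i a))
    (hInj : ∀ (v : Fin n) (S : Finset (Fin n)), (∀ u ∈ S, u < v) → ∀ (a : A) (b : Fin n → A),
      X v a = ∑ u ∈ S, X u (b u) →
        ∃ b' : Fin n → A, a = ∑ u ∈ S.filter (Γ.Adj · v), X u (b' u))
    (q : ℕ) (z : Clq Γ q →₀ A) (hz : koszulD X (clqExt R A Γ q z) = 0)
    (hz0 : ∃ b : Fin n → A, clqExt R A Γ q z ∅ = ∑ u, X u (b u)) :
    ∃ w, clqD X Γ q w = z := by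
  obtain ⟨w, hw, hw'⟩ := koszulD_exact hX hInj Finset.univ (clqExt R A Γ q z)
    (fun σ hσ => clqExt_of_notMem _ fun h => hσ ⟨h.1, Finset.subset_univ _⟩) hz hz0
  refine ⟨clqRes R A Γ (q + 1) w, clqExt_injective (R := R) ?_⟩
  rw [clqExt_clqD]
  funext τ
  by_cases hτ : τ.card = q
  · rw [← hw', koszulD_apply, koszulD_apply]
    refine Finset.sum_congr rfl fun i _ => ?_
    split_ifs with hi
    · rfl
    · by_cases h : insert i τ ∈ cliqueComplex Γ
      · have hc : (insert i τ).card = q + 1 := by rw [Finset.card_insert_of_notMem hi, hτ]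
        have : clqExt R A Γ (q + 1) (clqRes R A Γ (q + 1) w) (insert i τ) = w (insert i τ) :=
          (clqExt_of_mem _ ⟨insert i τ, h, hc⟩).trans (clqRes_apply _ _)
        rw [this]
      · rw [clqExt_of_notMem _ fun h' => h h'.1, hw _ fun h' => h h'.1]
  · rw [← clqExt_clqD, clqExt_of_notMem _ fun h => hτ h.2, clqExt_of_notMem _ fun h => hτ h.2]

end FinsuppKoszul

section Resolution

open CategoryTheory

variable {n : ℕ} (Γ : SimpleGraph (Fin n))

/-- Right multiplication by `v_i - 1` on the group algebra. -/
def genSubMul (i : Fin n) : MonoidAlgebra k (RAAG Γ) →ₗ[k] MonoidAlgebra k (RAAG Γ) :=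
  LinearMap.mulRight k (genSub k Γ i)

variable {k Γ}

lemma genSubMul_apply (i : Fin n) (a : MonoidAlgebra k (RAAG Γ)) :
    genSubMul k Γ i a = a * genSub k Γ i := rfl

lemma genSubMul_comm (i j : Fin n) (h : Γ.Adj i j) (a : MonoidAlgebra k (RAAG Γ)) :
    genSubMul k Γ i (genSubMul k Γ j a) = genSubMul k Γ j (genSubMul k Γ i a) := by
  simp only [genSubMul_apply, mul_assoc, genSub_comm h]

lemma leftRegular_eq_mul (g : RAAG Γ) (a : MonoidAlgebra k (RAAG Γ)) :
    Representation.leftRegular k (RAAG Γ) g a = MonoidAlgebra.single g 1 * a := by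
  induction a using MonoidAlgebra.induction_linear with
  | zero => simp
  | add f g hf hg => rw [map_add, mul_add, hf, hg]
  | single h r => simp [MonoidAlgebra.single_mul_single]

lemma free_eq_mapRange {α : Type} (g : RAAG Γ) (z : α →₀ MonoidAlgebra k (RAAG Γ)) :
    Representation.free k (RAAG Γ) α g z =
      Finsupp.mapRange.linearMap (Representation.leftRegular k (RAAG Γ) g) z := by
  induction z using Finsupp.induction_linear with
  | zero => simp
  | add f g hf hg => rw [map_add, map_add, hf, hg]
  | single a b => simp

variable (k Γ)

/-- The differential of the Koszul-type resolution of a right-angled Artin group. -/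
def raagResD (q : ℕ) :
    Rep.free k (RAAG Γ) (Clq Γ (q + 1)) ⟶ Rep.free k (RAAG Γ) (Clq Γ q) :=
  Rep.ofHom ⟨clqD (genSubMul k Γ) Γ q, fun g => by
    refine LinearMap.ext fun z => ?_
    rw [LinearMap.comp_apply, LinearMap.comp_apply, free_eq_mapRange, free_eq_mapRange]
    refine clqD_mapRange _ (fun i a => ?_) Γ q z
    simp only [leftRegular_eq_mul, genSubMul_apply, mul_assoc]⟩

lemma raagResD_apply (q : ℕ) (z : Clq Γ (q + 1) →₀ MonoidAlgebra k (RAAG Γ)) :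
    (raagResD k Γ q).hom z = clqD (genSubMul k Γ) Γ q z := rfl

/-- The Koszul-type complex of free modules resolving the trivial module. -/
def raagRes : ChainComplex (Rep k (RAAG Γ)) ℕ :=
  ChainComplex.of (fun q => Rep.free k (RAAG Γ) (Clq Γ q)) (raagResD k Γ) fun q => by
    refine Rep.free_ext k (RAAG Γ) _ _ _ fun i => ?_
    exact clqD_clqD genSubMul_comm q _

lemma raagRes_d (q : ℕ) : (raagRes k Γ).d (q + 1) q = raagResD k Γ q :=
  by unfold raagRes; exact ChainComplex.of_d (X := fun q => Rep.free k (RAAG Γ) (Clq Γ q)) _ q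

/-- The augmentation of the Koszul-type complex. -/
def raagAug : Rep.free k (RAAG Γ) (Clq Γ 0) ⟶ Rep.trivial k (RAAG Γ) k :=
  Rep.freeLift k (RAAG Γ) _ fun _ => (1 : k)

lemma raagAug_apply (z : Clq Γ 0 →₀ MonoidAlgebra k (RAAG Γ)) :
    (raagAug k Γ).hom z = MonoidAlgebra.lift k k (RAAG Γ) 1 (clqExt k _ Γ 0 z ∅) := by
  have h0 : ∀ σ : Clq Γ 0, σ.1 = ∅ := fun σ => Finset.card_eq_zero.1 σ.2.2
  induction z using Finsupp.induction_linear with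
  | zero => simp
  | add f g hf hg => rw [map_add, map_add, Pi.add_apply, map_add, hf, hg]
  | single σ a =>
    have h1 : clqExt k _ Γ 0 (Finsupp.single σ a) ∅ = a := by
      rw [← h0 σ, clqExt_of_mem, Finsupp.single_eq_same]
    rw [h1]
    clear h1
    induction a using MonoidAlgebra.induction_linear with
    | zero => simp
    | add f g hf hg => rw [Finsupp.single_add, map_add, map_add, hf, hg]
    | single g r => simp [raagAug, Representation.freeLift]

lemma koszulD_clqExt_zero {A : Type} [AddCommGroup A] [Module k A] (X : Fin n → A →ₗ[k] A)
    (z : Clq Γ 0 →₀ A) : koszulD X (clqExt k A Γ 0 z) = 0 := by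
  funext τ
  rw [koszulD_apply]
  refine Finset.sum_eq_zero fun i _ => ?_
  split_ifs with hi
  · rfl
  · rw [clqExt_of_notMem, map_zero, smul_zero]
    rintro ⟨-, h⟩
    rw [Finset.card_insert_of_notMem hi] at h
    omega

lemma range_raagResD_zero (z : Clq Γ 0 →₀ MonoidAlgebra k (RAAG Γ)) :
    (raagAug k Γ).hom z = 0 ↔ ∃ w, (raagResD k Γ 0).hom w = z := by
  rw [raagAug_apply]
  constructor
  · intro h
    refine clqD_exact genSubMul_comm ?_ 0 z (koszulD_clqExt_zero k Γ _ z)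
      (mem_augmentation_iff _ h)
    intro v S hS a b h
    exact genSub_colon v S (fun hv => (hS v hv).false) a b h
  · rintro ⟨w, rfl⟩
    rw [raagResD_apply, clqExt_clqD, koszulD_apply, map_sum]
    refine Finset.sum_eq_zero fun i _ => ?_
    rw [if_neg (by simp), map_zsmul, genSubMul_apply, map_mul, genSub, map_sub,
      map_one (MonoidAlgebra.lift k k (RAAG Γ) 1),
      MonoidAlgebra.lift_of, MonoidHom.one_apply, sub_self, mul_zero, smul_zero]

lemma range_raagResD_succ (q : ℕ) (z : Clq Γ (q + 1) →₀ MonoidAlgebra k (RAAG Γ)) :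
    (raagResD k Γ q).hom z = 0 ↔ ∃ w, (raagResD k Γ (q + 1)).hom w = z := by
  rw [raagResD_apply]
  constructor
  · intro h
    refine clqD_exact genSubMul_comm ?_ (q + 1) z ?_ ⟨0, ?_⟩
    · intro v S hS a b h
      exact genSub_colon v S (fun hv => (hS v hv).false) a b h
    · rw [← clqExt_clqD, h, map_zero]
    · rw [clqExt_of_notMem]
      · simp
      · rintro ⟨-, h⟩
        simp at h
  · rintro ⟨w, rfl⟩
    exact clqD_clqD genSubMul_comm q _

/-- The augmentation as a chain map. -/
def raagResπ : raagRes k Γ ⟶ (ChainComplex.single₀ _).obj (Rep.trivial k (RAAG Γ) k) :=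
  ((raagRes k Γ).toSingle₀Equiv _).symm ⟨raagAug k Γ, by
    rw [raagRes_d]
    refine Rep.free_ext k (RAAG Γ) _ _ _ fun i => ?_
    exact (range_raagResD_zero k Γ _).2 ⟨_, rfl⟩⟩

lemma raagRes_quasiIso : QuasiIso (raagResπ k Γ) where
  quasiIsoAt m := by
    cases m with
    | zero =>
      simp only [raagResπ]
      rw [ChainComplex.quasiIsoAt₀_iff, ShortComplex.quasiIso_iff_of_zeros' _ rfl rfl rfl]
      constructor
      · apply (forget₂ _ (ModuleCat k)).reflects_exact_of_faithful
        rw [ShortComplex.moduleCat_exact_iff]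
        intro z hz
        obtain ⟨w, hw⟩ := (range_raagResD_zero k Γ z).1 hz
        refine ⟨w, Eq.trans ?_ hw⟩
        rw [← raagRes_d]
        rfl
      · rw [Rep.epi_iff_surjective]
        intro x
        refine ⟨(Finsupp.single ⟨∅, by simp [cliqueComplex]⟩ (MonoidAlgebra.single 1 x) :
          Clq Γ 0 →₀ MonoidAlgebra k (RAAG Γ)), ?_⟩
        refine (raagAug_apply k Γ _).trans ?_
        rw [show clqExt k _ Γ 0 _ ∅ = _ from clqExt_of_mem _ ⟨∅, by simp [cliqueComplex]⟩,
          Finsupp.single_eq_same]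
        exact (MonoidAlgebra.lift_single ..).trans (mul_one _)
    | succ m =>
      rw [quasiIsoAt_iff_exactAt' (hL := ChainComplex.exactAt_succ_single_obj ..),
          HomologicalComplex.exactAt_iff' _ (m + 2) (m + 1) m (by simp) (by simp)]
      apply (forget₂ _ (ModuleCat k)).reflects_exact_of_faithful
      rw [ShortComplex.moduleCat_exact_iff]
      intro z hz
      obtain ⟨w, hw⟩ := (range_raagResD_succ k Γ m z).1 (by
        rw [← raagRes_d]
        exact hz)
      refine ⟨w, Eq.trans ?_ hw⟩
      rw [← raagRes_d]
      rfl

/-- The Koszul-type projective resolution. -/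
def raagResolution : ProjectiveResolution (Rep.trivial k (RAAG Γ) k) where
  complex := raagRes k Γ
  projective q := inferInstanceAs (Projective (Rep.free k (RAAG Γ) (Clq Γ q)))
  π := raagResπ k Γ
  quasiIso := raagRes_quasiIso k Γ

end Resolution

section HomologyFinite

lemma finite_iff_exists_fg {k : Type*} [Field k] {M H : Type*} [AddCommGroup M] [Module k M]
    [AddCommGroup H] [Module k H] (Z B : Submodule k M) (π : Z →ₗ[k] H)
    (hπ : Function.Surjective π) (hB : ∀ z, π z = 0 ↔ (z : M) ∈ B) (hBZ : B ≤ Z) :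
    Module.Finite k H ↔ ∃ U : Submodule k M, U.FG ∧ ∀ z ∈ Z, ∃ u ∈ U, z - u ∈ B := by
  constructor
  · intro hH
    obtain ⟨s, hs⟩ := LinearMap.exists_rightInverse_of_surjective π (LinearMap.range_eq_top.2 hπ)
    refine ⟨LinearMap.range (Z.subtype ∘ₗ s), ?_, fun z hz => ⟨_, ⟨π ⟨z, hz⟩, rfl⟩, ?_⟩⟩
    · rw [LinearMap.range_eq_map]
      exact hH.fg_top.map _
    · have := (hB (⟨z, hz⟩ - s (π ⟨z, hz⟩))).1 (by
        rw [map_sub, ← LinearMap.comp_apply π s, hs, LinearMap.id_apply, sub_self])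
      exact this
  · rintro ⟨U, hU, h⟩
    have : Module.Finite k U := Module.Finite.iff_fg.2 hU
    have : Module.Finite k (U.comap Z.subtype) :=
      Module.Finite.of_injective (Z.subtype.restrict (p := U.comap Z.subtype) (q := U)
        fun _ hx => hx) fun x y hxy => by
          have := congrArg Subtype.val hxy
          exact Subtype.ext (Subtype.ext this)
    refine Module.Finite.of_surjective (π ∘ₗ (U.comap Z.subtype).subtype) fun x => ?_
    obtain ⟨z, rfl⟩ := hπ x
    obtain ⟨u, hu, hzu⟩ := h z z.2
    have huZ : u ∈ Z := by
      have := Z.sub_mem z.2 (hBZ hzu)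
      rwa [sub_sub_cancel] at this
    refine ⟨⟨⟨u, huZ⟩, hu⟩, ?_⟩
    have := (hB (z - ⟨u, huZ⟩)).2 hzu
    rw [map_sub, sub_eq_zero] at this
    exact this.symm

open CategoryTheory

lemma finite_homology_iff {k : Type} [Field k] (C : ChainComplex (ModuleCat.{0} k) ℕ) (q : ℕ) :
    Module.Finite k (C.homology q) ↔ ∃ U : Submodule k (C.X q), U.FG ∧
      ∀ z, C.d q (q - 1) z = 0 → ∃ u ∈ U, ∃ v, z = u + C.d (q + 1) q v := by
  have hnext : (ComplexShape.down ℕ).next q = q - 1 := by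
    cases q with
    | zero => simp
    | succ q => simp
  let S := C.sc' (q + 1) q (q - 1)
  let e : C.homology q ≅ S.moduleCatLeftHomologyData.H :=
    C.homologyIsoSc' (q + 1) q (q - 1) (by simp) hnext ≪≫ S.moduleCatHomologyIso
  have he : Module.Finite k (C.homology q) ↔ Module.Finite k S.moduleCatLeftHomologyData.H :=
    ⟨fun _ => Module.Finite.equiv e.toLinearEquiv,
      fun _ => Module.Finite.equiv e.toLinearEquiv.symm⟩
  rw [he]
  refine (finite_iff_exists_fg (LinearMap.ker S.g.hom) (LinearMap.range S.f.hom)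
    (LinearMap.range S.moduleCatToCycles).mkQ (Submodule.mkQ_surjective _) ?_ ?_).trans ?_
  · intro z
    rw [Submodule.mkQ_apply, Submodule.Quotient.mk_eq_zero]
    constructor
    · rintro ⟨v, hv⟩
      exact ⟨v, congrArg Subtype.val hv⟩
    · rintro ⟨v, hv⟩
      exact ⟨v, Subtype.ext hv⟩
  · rintro _ ⟨v, rfl⟩
    exact S.moduleCat_zero_apply v
  · refine exists_congr fun U => and_congr_right fun _ => forall_congr' fun z =>
      imp_congr_right fun _ => exists_congr fun u => and_congr_right fun _ => ?_
    constructor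
    · rintro ⟨v, hv⟩
      exact ⟨v, (eq_add_of_sub_eq' hv.symm)⟩
    · rintro ⟨v, hv⟩
      exact ⟨v, (sub_eq_of_eq_add' hv).symm⟩

/-- The Laurent ring as a representation of `G` through `φ`. -/
def laurentRho : Representation k G (LaurentRing k m) where
  toFun g := LinearMap.mulLeft k (AddMonoidAlgebra.single (φ g).toAdd (1 : k))
  map_one' := by
    ext
    simp [← AddMonoidAlgebra.one_def]
  map_mul' g h := by
    refine LinearMap.ext fun x => ?_
    simp [← mul_assoc, AddMonoidAlgebra.single_mul_single]

lemma laurentRho_apply (g : G) (a : LaurentRing k m) :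
    laurentRho k φ g a = AddMonoidAlgebra.single (φ g).toAdd (1 : k) * a := rfl

lemma inhomogD_eq (q : ℕ) (z : inhomogChains k m G (q + 1)) :
    (groupHomology.inhomogeneousChains.d (Rep.of (laurentRho k φ)) q).hom z =
      inhomogD k φ q z := by
  induction z using Finsupp.induction_linear with
  | zero => exact (map_zero _).trans (map_zero (inhomogD k φ q)).symm
  | add f g hf hg =>
    rw [(inhomogD k φ q).map_add, ← hf, ← hg]
    exact LinearMap.map_add _ _ _
  | single g a =>
    refine (groupHomology.inhomogeneousChains.d_single (A := Rep.of (laurentRho k φ))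
      q g a).trans ?_
    rw [inhomogD, Finsupp.lsum_single, LinearMap.add_apply, LinearMap.sum_apply]
    refine congrArg₂ (· + ·) ?_ (Finset.sum_congr rfl fun j _ => ?_)
    · rw [LinearMap.comp_apply]
      refine congrArg (Finsupp.single _) ?_
      change laurentRho k φ (g 0)⁻¹ a = _
      simp [laurentRho_apply, yMul]
    · rw [LinearMap.smul_apply, Finsupp.lsingle_apply]
      rcases Nat.even_or_odd ((j : ℕ) + 1) with h | h
      · rw [h.neg_one_pow, h.neg_one_pow, one_smul, one_smul]
      · rw [h.neg_one_pow, h.neg_one_pow, neg_one_smul, neg_one_smul]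

lemma inhomogDpre_eq (q : ℕ) (z : inhomogChains k m G q) :
    ((groupHomology.inhomogeneousChains (Rep.of (laurentRho k φ))).d q (q - 1)).hom z =
      inhomogDpre k φ q z := by
  cases q with
  | zero =>
    have : (groupHomology.inhomogeneousChains (Rep.of (laurentRho k φ))).d 0 (0 - 1) = 0 :=
      HomologicalComplex.shape _ _ _ (by simp)
    rw [this]
    rfl
  | succ q =>
    change ((groupHomology.inhomogeneousChains (Rep.of (laurentRho k φ))).d (q + 1) q).hom z = _
    rw [groupHomology.inhomogeneousChains.d_def]
    exact inhomogD_eq k φ q z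

lemma inhomogDpre_inhomogD (q : ℕ) (v : inhomogChains k m G (q + 1)) :
    inhomogDpre k φ q (inhomogD k φ q v) = 0 := by
  rw [← inhomogDpre_eq, ← inhomogD_eq, ← groupHomology.inhomogeneousChains.d_def]
  exact congrArg (fun h => h.hom v)
    ((groupHomology.inhomogeneousChains (Rep.of (laurentRho k φ))).d_comp_d (q + 1) q (q - 1))

lemma finite_groupHomologyLaurent_iff (q : ℕ) :
    Module.Finite k (groupHomologyLaurent k φ q) ↔
      Module.Finite k (groupHomology (Rep.of (laurentRho k φ)) q) := by
  let B := (LinearMap.range (inhomogD k φ q)).restrictScalars k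
  let Z := (LinearMap.ker (inhomogDpre k φ q)).restrictScalars k
  have hBZ : B ≤ Z := by
    rintro _ ⟨v, rfl⟩
    exact inhomogDpre_inhomogD k φ q v
  let π : Z →ₗ[k] groupHomologyLaurent k φ q :=
    { toFun := fun z => ⟨_, Submodule.mem_map_of_mem z.2⟩
      map_add' := fun x y => rfl
      map_smul' := fun c x => by
        refine Subtype.ext ?_
        change (LinearMap.range (inhomogD k φ q)).mkQ (c • (x : inhomogChains k m G q)) =
          algebraMap k (LaurentRing k m) c • (LinearMap.range (inhomogD k φ q)).mkQ x
        rw [← map_smul, algebraMap_smul] }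
  refine (finite_iff_exists_fg Z B π ?_ ?_ hBZ).trans
    (Iff.trans ?_ (finite_homology_iff _ q).symm)
  · rintro ⟨_, z, hz, rfl⟩
    exact ⟨⟨z, hz⟩, rfl⟩
  · intro z
    refine Subtype.ext_iff.trans ?_
    exact (Submodule.Quotient.mk_eq_zero _)
  · refine exists_congr fun U => and_congr_right fun _ => forall_congr' fun z =>
      imp_congr ?_ (exists_congr fun u => and_congr_right fun _ => ?_)
    · exact (Eq.congr_left (inhomogDpre_eq k φ q z)).symm
    · rw [groupHomology.inhomogeneousChains.d_def]
      refine exists_congr fun v => ?_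
      rw [eq_comm, sub_eq_iff_eq_add', ← inhomogD_eq]

end HomologyFinite

section TensorResolution

open CategoryTheory

variable {n : ℕ} (Γ : SimpleGraph (Fin n)) (ψ : RAAG Γ →* Multiplicative (Fin m → ℤ))

/-- The algebra map `k[G] → k[ℤᵐ]` through which the right action on the Laurent ring factors. -/
def laurentMap : MonoidAlgebra k (RAAG Γ) →ₐ[k] LaurentRing k m :=
  MonoidAlgebra.lift k (LaurentRing k m) (RAAG Γ) ((AddMonoidAlgebra.of k (Fin m → ℤ)).comp ψ⁻¹)

lemma laurentMap_single (g : RAAG Γ) (r : k) :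
    laurentMap k Γ ψ (MonoidAlgebra.single g r) =
      r • AddMonoidAlgebra.single (ψ g⁻¹).toAdd (1 : k) := by
  rw [laurentMap, MonoidAlgebra.lift_single, map_inv]
  rfl

/-- The action of `v_i⁻¹ - 1` on the Laurent ring. -/
def laurentX (i : Fin n) : LaurentRing k m →ₗ[k] LaurentRing k m :=
  LinearMap.mulLeft k (laurentMap k Γ ψ (genSub k Γ i))

lemma coinvariantsTensorFreeToFinsupp_mk_tmul {α : Type} [DecidableEq α] (a : LaurentRing k m)
    (z : α →₀ MonoidAlgebra k (RAAG Γ)) :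
    (Rep.coinvariantsTensorFreeToFinsupp (Rep.of (laurentRho k ψ)) α)
      (Representation.Coinvariants.mk _ (a ⊗ₜ[k] z)) =
    Finsupp.mapRange.linearMap
      (LinearMap.mulRight k a ∘ₗ (laurentMap k Γ ψ).toLinearMap) z := by
  induction z using Finsupp.induction_linear with
  | zero => rw [TensorProduct.tmul_zero, map_zero, map_zero, map_zero]
  | add f g hf hg => rw [TensorProduct.tmul_add, map_add, map_add, map_add, hf, hg]
  | single i z =>
    induction z using MonoidAlgebra.induction_linear with
    | zero => rw [Finsupp.single_zero, TensorProduct.tmul_zero, map_zero, map_zero, map_zero]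
    | add f g hf hg =>
      rw [Finsupp.single_add, TensorProduct.tmul_add, map_add, map_add, map_add, hf, hg]
    | single g r =>
      refine (Rep.coinvariantsTensorFreeToFinsupp_mk_tmul_single
        (Rep.of (laurentRho k ψ)) a i g r).trans ?_
      rw [Finsupp.mapRange.linearMap_apply, Finsupp.mapRange_single]
      refine congrArg (Finsupp.single i) ?_
      change r • laurentRho k ψ g⁻¹ a = laurentMap k Γ ψ (MonoidAlgebra.single g r) * a
      rw [laurentMap_single, laurentRho_apply, smul_mul_assoc]

/-- The Koszul-type complex computing the homology of a right-angled Artin group with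
coefficients in the Laurent ring. -/
def laurentKoszul : ChainComplex (ModuleCat.{0} k) ℕ :=
  ChainComplex.of (fun q => ModuleCat.of k (Clq Γ q →₀ LaurentRing k m))
    (fun q => ModuleCat.ofHom (clqD (laurentX k Γ ψ) Γ q)) fun q => by
      ext : 1
      refine LinearMap.ext fun z => clqD_clqD (fun i j _ a => ?_) q z
      simp only [laurentX, LinearMap.mulLeft_apply]
      ring

lemma laurentKoszul_d (q : ℕ) :
    (laurentKoszul k Γ ψ).d (q + 1) q = ModuleCat.ofHom (clqD (laurentX k Γ ψ) Γ q) := by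
  simp [laurentKoszul]

lemma clqD_laurentMap (a : LaurentRing k m) (q : ℕ)
    (z : Clq Γ (q + 1) →₀ MonoidAlgebra k (RAAG Γ)) :
    clqD (laurentX k Γ ψ) Γ q (Finsupp.mapRange.linearMap
        (LinearMap.mulRight k a ∘ₗ (laurentMap k Γ ψ).toLinearMap) z) =
      Finsupp.mapRange.linearMap (LinearMap.mulRight k a ∘ₗ (laurentMap k Γ ψ).toLinearMap)
        (clqD (genSubMul k Γ) Γ q z) := by
  refine clqD_mapRange _ (fun i x => ?_) Γ q z
  simp only [LinearMap.comp_apply, AlgHom.toLinearMap_apply, genSubMul_apply, map_mul,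
    LinearMap.mulRight_apply, laurentX, LinearMap.mulLeft_apply]
  ring

lemma coinvariantsTensor_map_raagResD (q : ℕ) :
    (Rep.coinvariantsTensorFreeLEquiv (Rep.of (laurentRho k ψ)) (Clq Γ (q + 1))).toModuleIso.hom ≫
        ModuleCat.ofHom (clqD (laurentX k Γ ψ) Γ q) =
      ((Rep.coinvariantsTensor k (RAAG Γ)).obj (Rep.of (laurentRho k ψ))).map (raagResD k Γ q) ≫
        (Rep.coinvariantsTensorFreeLEquiv (Rep.of (laurentRho k ψ)) (Clq Γ q)).toModuleIso.hom := by
  refine Rep.coinvariantsTensor_hom_ext (LinearMap.ext fun a => LinearMap.ext fun z => ?_)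
  trans clqD (laurentX k Γ ψ) Γ q (Rep.coinvariantsTensorFreeToFinsupp (Rep.of (laurentRho k ψ)) _
    (Representation.Coinvariants.mk _ (a ⊗ₜ[k] z)))
  · rfl
  trans Rep.coinvariantsTensorFreeToFinsupp (Rep.of (laurentRho k ψ)) _
    (Representation.Coinvariants.mk _ (a ⊗ₜ[k] ((raagResD k Γ q).hom z)))
  swap
  · rfl
  have h₁ := coinvariantsTensorFreeToFinsupp_mk_tmul k Γ ψ a z
  have h₂ := coinvariantsTensorFreeToFinsupp_mk_tmul k Γ ψ a ((raagResD k Γ q).hom z)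
  exact (congrArg (clqD (laurentX k Γ ψ) Γ q) h₁).trans
    ((clqD_laurentMap k Γ ψ a q z).trans h₂.symm)

/-- Tensoring the Koszul-type resolution with the Laurent ring. -/
def tensorResolutionIso :
    (raagResolution k Γ).complex.coinvariantsTensorObj (Rep.of (laurentRho k ψ)) ≅
      laurentKoszul k Γ ψ :=
  HomologicalComplex.Hom.isoOfComponents
    (fun q => (Rep.coinvariantsTensorFreeLEquiv (Rep.of (laurentRho k ψ)) (Clq Γ q)).toModuleIso)
    fun i j h => by
      cases h
      rw [laurentKoszul_d]
      refine (coinvariantsTensor_map_raagResD k Γ ψ j).trans ?_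
      rw [← raagRes_d]
      rfl

end TensorResolution

section FiniteHomologyMatrix

variable {n : ℕ} (Γ : SimpleGraph (Fin n)) (f : Fin n → Fin m)

/-- The type of cliques of a graph. -/
abbrev Clique {n : ℕ} (Γ : SimpleGraph (Fin n)) : Type :=
  {σ : Finset (Fin n) // σ ∈ cliqueComplex Γ}

/-- The matrix of left multiplication by `h_j` on the exterior Stanley–Reisner ring. -/
def incidence (j : Fin m) : Matrix (Clique Γ) (Clique Γ) k := fun σ τ =>
  ∑ i, if f i = j ∧ i ∈ σ.1 ∧ σ.1.erase i = τ.1 then (koszulSign i τ.1 : k) else 0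

/-- The element `y_j⁻¹ - 1` of the Laurent ring. -/
def laurentVar (j : Fin m) : LaurentRing k m :=
  AddMonoidAlgebra.single (-Pi.single j 1) 1 - 1

/-- The differential `∑ x_j M_jᵀ` on the free module over `R`. -/
def deformedD {ι R : Type*} [CommRing R] [Algebra k R] (x : Fin m → R)
    (M : Fin m → Matrix ι ι k) : Matrix ι ι R :=
  ∑ j, x j • (M j).transpose.map (algebraMap k R)

/-- The homology of `D` is finite-dimensional over `k`. -/
def HasFiniteHomology {ι R : Type*} [Fintype ι] [CommRing R] [Algebra k R] (D : Matrix ι ι R) :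
    Prop :=
  ∃ U : Submodule k (ι → R), U.FG ∧ ∀ z, D.mulVec z = 0 → ∃ u ∈ U, ∃ v, z = u + D.mulVec v

/-- The component of degree `q`. -/
def clqProj (q : ℕ) : (Clique Γ → LaurentRing k m) →ₗ[k] (Clq Γ q →₀ LaurentRing k m) :=
  (Finsupp.linearEquivFunOnFinite k _ (Clq Γ q)).symm.toLinearMap ∘ₗ
    LinearMap.funLeft k _ fun σ => ⟨σ.1, σ.2.1⟩

lemma clqProj_apply (q : ℕ) (z : Clique Γ → LaurentRing k m) (σ : Clq Γ q) :
    clqProj k Γ q z σ = z ⟨σ.1, σ.2.1⟩ := by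
  simp [clqProj, LinearMap.funLeft]

/-- The inclusion of the component of degree `q`. -/
def clqIncl (q : ℕ) : (Clq Γ q →₀ LaurentRing k m) →ₗ[k] (Clique Γ → LaurentRing k m) :=
  LinearMap.funLeft k _ Subtype.val ∘ₗ clqExt k _ Γ q

lemma clqProj_clqIncl (q : ℕ) (z : Clq Γ q →₀ LaurentRing k m) :
    clqProj k Γ q (clqIncl k Γ q z) = z := by
  ext1 σ
  rw [clqProj_apply]
  exact clqExt_of_mem z σ

lemma clqProj_clqIncl_of_ne {p q : ℕ} (h : p ≠ q) (z : Clq Γ q →₀ LaurentRing k m) :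
    clqProj k Γ p (clqIncl k Γ q z) = 0 := by
  ext1 σ
  rw [clqProj_apply]
  exact clqExt_of_notMem z fun h' => h (σ.2.2.symm.trans h'.2)

lemma clique_ext {z w : Clique Γ → LaurentRing k m}
    (h : ∀ q, clqProj k Γ q z = clqProj k Γ q w) : z = w := by
  funext σ
  have := DFunLike.congr_fun (h σ.1.card) ⟨σ.1, σ.2, rfl⟩
  rwa [clqProj_apply, clqProj_apply] at this

lemma sum_clqIncl_clqProj (z : Clique Γ → LaurentRing k m) :
    ∑ q ∈ Finset.range (n + 1), clqIncl k Γ q (clqProj k Γ q z) = z := by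
  refine clique_ext k Γ fun p => ?_
  rw [map_sum]
  by_cases hp : p ∈ Finset.range (n + 1)
  · rw [Finset.sum_eq_single_of_mem p hp fun q _ h => clqProj_clqIncl_of_ne k Γ h.symm _,
      clqProj_clqIncl]
  · ext1 σ
    refine absurd ?_ hp
    rw [Finset.mem_range, Nat.lt_succ_iff, ← σ.2.2]
    exact (Finset.card_le_univ _).trans_eq (Fintype.card_fin n)

lemma deformedD_incidence_apply {R : Type*} [CommRing R] [Algebra k R] (x : Fin m → R)
    (τ σ : Clique Γ) :
    deformedD k x (incidence k Γ f) τ σ =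
      ∑ i, if i ∈ σ.1 ∧ σ.1.erase i = τ.1 then koszulSign i τ.1 • x (f i) else 0 := by
  simp only [deformedD, Matrix.sum_apply, Matrix.smul_apply, Matrix.map_apply,
    Matrix.transpose_apply, incidence, map_sum, smul_eq_mul, Finset.mul_sum]
  rw [Finset.sum_comm]
  refine Finset.sum_congr rfl fun i _ => ?_
  rw [Finset.sum_eq_single (f i)]
  · simp only [true_and]
    split_ifs with h
    · rw [map_intCast, zsmul_eq_mul, mul_comm]
    · simp
  · intro j _ hj
    rw [if_neg fun h => hj h.1.symm, map_zero, mul_zero]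
  · simp

lemma clqProj_deformedD (X : Fin n → LaurentRing k m →ₗ[k] LaurentRing k m)
    (hX : ∀ i a, X i a = laurentVar k (f i) * a) (q : ℕ) (z : Clique Γ → LaurentRing k m) :
    clqProj k Γ q ((deformedD k (laurentVar k) (incidence k Γ f)).mulVec z) =
      clqD X Γ q (clqProj k Γ (q + 1) z) := by
  ext1 τ
  rw [clqProj_apply, ← clqExt_of_mem (R := k), clqExt_clqD, koszulD_apply]
  simp only [Matrix.mulVec, dotProduct, deformedD_incidence_apply, Finset.sum_mul]
  rw [Finset.sum_comm]
  refine Finset.sum_congr rfl fun i _ => ?_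
  have hcard : i ∉ τ.1 → (insert i τ.1).card = q + 1 := fun hi => by
    rw [Finset.card_insert_of_notMem hi, τ.2.2]
  split_ifs with hi
  · refine Finset.sum_eq_zero fun σ _ => ?_
    rw [if_neg, zero_mul]
    rintro ⟨-, h⟩
    rw [← h] at hi
    exact Finset.notMem_erase _ _ hi
  · rw [hX]
    by_cases hK : insert i τ.1 ∈ cliqueComplex Γ
    · rw [Finset.sum_eq_single ⟨insert i τ.1, hK⟩, if_pos
        ⟨Finset.mem_insert_self _ _, Finset.erase_insert hi⟩, smul_mul_assoc]
      · congr 2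
        exact (clqProj_apply k Γ (q + 1) z ⟨_, hK, hcard hi⟩).symm.trans
          (clqExt_of_mem _ ⟨_, hK, hcard hi⟩).symm
      · intro σ _ hσ
        rw [if_neg, zero_mul]
        rintro ⟨h, h'⟩
        exact hσ (Subtype.ext ((Finset.insert_erase h).symm.trans (congrArg _ h')))
      · simp
    · rw [clqExt_of_notMem _ fun h => hK h.1, mul_zero, smul_zero]
      refine Finset.sum_eq_zero fun σ _ => ?_
      rw [if_neg, zero_mul]
      rintro ⟨h, h'⟩
      exact hK (by rw [← h', Finset.insert_erase h]; exact σ.2)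

lemma deformedD_clqIncl (X : Fin n → LaurentRing k m →ₗ[k] LaurentRing k m)
    (hX : ∀ i a, X i a = laurentVar k (f i) * a) (q : ℕ) (z : Clq Γ (q + 1) →₀ LaurentRing k m) :
    (deformedD k (laurentVar k) (incidence k Γ f)).mulVec (clqIncl k Γ (q + 1) z) =
      clqIncl k Γ q (clqD X Γ q z) := by
  refine clique_ext k Γ fun p => ?_
  rw [clqProj_deformedD k Γ f X hX]
  by_cases h : p = q
  · subst h
    rw [clqProj_clqIncl, clqProj_clqIncl]
  · rw [clqProj_clqIncl_of_ne k Γ (by omega), clqProj_clqIncl_of_ne k Γ h, map_zero]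

open CategoryTheory in
lemma finite_groupHomologyLaurent_iff_clq (ψ : RAAG Γ →* Multiplicative (Fin m → ℤ)) (q : ℕ) :
    Module.Finite k (groupHomologyLaurent k ψ q) ↔
      ∃ U : Submodule k (Clq Γ q →₀ LaurentRing k m), U.FG ∧
        ∀ z, (∀ p, q = p + 1 →
          clqD (laurentX k Γ ψ) Γ p (clqProj k Γ (p + 1) (clqIncl k Γ q z)) = 0) →
          ∃ u ∈ U, ∃ v, z = u + clqD (laurentX k Γ ψ) Γ q v := by
  rw [finite_groupHomologyLaurent_iff]
  let e : groupHomology (Rep.of (laurentRho k ψ)) q ≅ (laurentKoszul k Γ ψ).homology q :=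
    groupHomologyIso (Rep.of (laurentRho k ψ)) q (raagResolution k Γ) ≪≫
      (HomologicalComplex.homologyFunctor _ _ q).mapIso (tensorResolutionIso k Γ ψ)
  have he : Module.Finite k (groupHomology (Rep.of (laurentRho k ψ)) q) ↔
      Module.Finite k ((laurentKoszul k Γ ψ).homology q) :=
    ⟨fun _ => Module.Finite.equiv e.toLinearEquiv,
      fun _ => Module.Finite.equiv e.toLinearEquiv.symm⟩
  rw [he, finite_homology_iff]
  refine exists_congr fun U => and_congr_right fun _ => forall_congr' fun z =>
    imp_congr ?_ (exists_congr fun u => and_congr_right fun _ => ?_)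
  · cases q with
    | zero =>
      have : (laurentKoszul k Γ ψ).d 0 (0 - 1) = 0 := HomologicalComplex.shape _ _ _ (by simp)
      rw [this]
      exact ⟨fun _ p hp => by omega, fun _ => rfl⟩
    | succ q =>
      change (laurentKoszul k Γ ψ).d (q + 1) q z = 0 ↔ _
      rw [laurentKoszul_d]
      constructor
      · intro h p hp
        obtain rfl : q = p := by omega
        exact (congrArg _ (clqProj_clqIncl k Γ (q + 1) z)).trans h
      · intro h
        exact (congrArg _ (clqProj_clqIncl k Γ (q + 1) z)).symm.trans (h q rfl)
  · rw [laurentKoszul_d]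
    rfl

lemma forall_finite_groupHomologyLaurent_iff (ψ : RAAG Γ →* Multiplicative (Fin m → ℤ))
    (hψ : ∀ i : Fin n, ψ (PresentedGroup.of i) = Multiplicative.ofAdd (Pi.single (f i) 1)) :
    (∀ q, Module.Finite k (groupHomologyLaurent k ψ q)) ↔
      HasFiniteHomology k (deformedD k (laurentVar k) (incidence k Γ f)) := by
  have hX : ∀ i a, laurentX k Γ ψ i a = laurentVar k (f i) * a := by
    intro i a
    rw [laurentX, LinearMap.mulLeft_apply, genSub, map_sub, map_one, MonoidAlgebra.of_apply,
      laurentMap_single, map_inv, hψ, one_smul]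
    rfl
  simp only [finite_groupHomologyLaurent_iff_clq k Γ ψ]
  constructor
  · intro h
    choose U hU h using h
    refine ⟨⨆ q ∈ Finset.range (n + 1), (U q).map (clqIncl k Γ q),
      Submodule.fg_biSup _ _ fun q _ => (hU q).map _, fun z hz => ?_⟩
    have hz' : ∀ q, ∃ u ∈ U q, ∃ v, clqProj k Γ q z = u + clqD (laurentX k Γ ψ) Γ q v := by
      refine fun q => h q _ fun p hp => ?_
      subst hp
      rw [clqProj_clqIncl, ← clqProj_deformedD k Γ f _ hX, hz, map_zero]
    choose u hu v huv using hz'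
    refine ⟨∑ q ∈ Finset.range (n + 1), clqIncl k Γ q (u q),
      Submodule.sum_mem _ fun q hq => ?_,
      ∑ q ∈ Finset.range (n + 1), clqIncl k Γ (q + 1) (v q), ?_⟩
    · exact Submodule.mem_iSup_of_mem q (Submodule.mem_iSup_of_mem hq
        (Submodule.mem_map_of_mem (hu q)))
    · rw [Matrix.mulVec_sum, ← Finset.sum_add_distrib, ← sum_clqIncl_clqProj k Γ z]
      refine Finset.sum_congr rfl fun q _ => ?_
      rw [deformedD_clqIncl k Γ f _ hX, ← map_add, huv, map_add]
  · rintro ⟨U, hU, h⟩ q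
    refine ⟨U.map (clqProj k Γ q), hU.map _, fun z hz => ?_⟩
    obtain ⟨u, hu, v, huv⟩ := h (clqIncl k Γ q z) (by
      cases q with
      | zero =>
        refine clique_ext k Γ fun p => ?_
        rw [clqProj_deformedD k Γ f _ hX, clqProj_clqIncl_of_ne k Γ (by omega), map_zero, map_zero]
      | succ q =>
        have := hz q rfl
        rw [clqProj_clqIncl] at this
        rw [deformedD_clqIncl k Γ f _ hX, this, map_zero])
    refine ⟨_, Submodule.mem_map_of_mem hu, clqProj k Γ (q + 1) v, ?_⟩
    rw [← clqProj_deformedD k Γ f _ hX, ← map_add, ← huv, clqProj_clqIncl]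

end FiniteHomologyMatrix

section TotalHomology

open CategoryTheory

variable {n : ℕ} (Γ : SimpleGraph (Fin n)) (f : Fin n → Fin m)

lemma subsingleton_groupHomologyLaurent (q : ℕ)
    (h : Limits.IsZero (groupHomology (Rep.of (laurentRho k φ)) q)) :
    Subsingleton (groupHomologyLaurent k φ q) := by
  have hnext : (ComplexShape.down ℕ).next q = q - 1 := by
    cases q with
    | zero => simp
    | succ q => simp
  have hex := (HomologicalComplex.exactAt_iff_isZero_homology _ _).2 h
  rw [HomologicalComplex.exactAt_iff' _ (q + 1) q (q - 1) (by simp) hnext,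
    ShortComplex.moduleCat_exact_iff] at hex
  refine subsingleton_of_forall_eq 0 ?_
  rintro ⟨_, z, hz, rfl⟩
  refine Subtype.ext ((Submodule.Quotient.mk_eq_zero _).2 ?_)
  obtain ⟨v, hv⟩ := hex z ((inhomogDpre_eq k φ q z).trans hz)
  have hd : (groupHomology.inhomogeneousChains.d (Rep.of (laurentRho k φ)) q).hom v = z := by
    rw [← groupHomology.inhomogeneousChains.d_def]
    exact hv
  exact ⟨v, (inhomogD_eq k φ q v).symm.trans hd⟩

lemma subsingleton_groupHomologyLaurent_of_lt (ψ : RAAG Γ →* Multiplicative (Fin m → ℤ)) {q : ℕ}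
    (hq : n < q) : Subsingleton (groupHomologyLaurent k ψ q) := by
  refine subsingleton_groupHomologyLaurent k ψ q ?_
  have : IsEmpty (Clq Γ q) := ⟨fun σ => hq.not_ge (by
    rw [← σ.2.2]
    exact (Finset.card_le_univ _).trans_eq (Fintype.card_fin n))⟩
  have h0 : Limits.IsZero ((laurentKoszul k Γ ψ).X q) :=
    (ModuleCat.isZero_of_subsingleton (ModuleCat.of k (Clq Γ q →₀ LaurentRing k m)))
  refine Limits.IsZero.of_iso ?_ (groupHomologyIso (Rep.of (laurentRho k ψ)) q
    (raagResolution k Γ) ≪≫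
      (HomologicalComplex.homologyFunctor _ _ q).mapIso (tensorResolutionIso k Γ ψ))
  exact (HomologicalComplex.exactAt_iff_isZero_homology _ _).1
    (ShortComplex.exact_of_isZero_X₂ _ h0)

lemma finiteDimensional_directSum_iff {M : ℕ → Type*} [∀ q, AddCommGroup (M q)]
    [∀ q, Module k (M q)] (hM : ∀ q, n < q → Subsingleton (M q)) :
    FiniteDimensional k (⨁ q, M q) ↔ ∀ q, Module.Finite k (M q) := by
  constructor
  · intro h q
    exact Module.Finite.of_surjective (DirectSum.component k ℕ M q)
      fun x => ⟨DirectSum.lof k ℕ M q x, DirectSum.component.lof_self k q x⟩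
  · intro h
    have hinj : Function.Injective (LinearMap.pi fun q : Fin (n + 1) =>
        DirectSum.component k ℕ M (q : ℕ)) := by
      intro x y hxy
      refine DFinsupp.ext fun q => ?_
      by_cases hq : n < q
      · have := hM q hq
        exact Subsingleton.elim _ _
      · exact congrFun hxy ⟨q, by omega⟩
    exact Module.Finite.of_injective _ hinj

end TotalHomology

section ExactModulo

variable {V : Type*} [AddCommGroup V] [Module k V]

/-- The complex with differential `g` on `V / L` is exact. -/
def ExactMod (g : V →ₗ[k] V) (L : Submodule k V) : Prop :=
  ∀ x, g x ∈ L → ∃ y, x - g y ∈ L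

variable {k} {g h : V →ₗ[k] V} {L : Submodule k V}

lemma ExactMod.of_sup (hgL : ∀ x ∈ L, g x ∈ L) (hhL : ∀ x ∈ L, h x ∈ L)
    (hg : ∀ x, g (g x) = 0) (hh : ∀ x, h (h x) = 0) (hgh : ∀ x, g (h x) = -h (g x))
    (eg : ExactMod k g (L ⊔ LinearMap.range h)) (eh : ExactMod k h L) : ExactMod k g L := by
  intro x hx
  obtain ⟨y, hy⟩ := eg x (Submodule.mem_sup_left hx)
  obtain ⟨l, hl, _, ⟨z, rfl⟩, hz⟩ := Submodule.mem_sup.1 hy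
  obtain rfl : x = g y + l + h z := by rw [add_assoc, hz]; abel
  simp only [map_add, hg, zero_add, hgh] at hx
  obtain ⟨w, hw⟩ := eh (g z) (by simpa using L.sub_mem (hgL l hl) hx)
  obtain ⟨y', hy'⟩ := eg z (by
    rw [← sub_add_cancel (g z) (h w)]
    exact add_mem (Submodule.mem_sup_left hw) (Submodule.mem_sup_right ⟨w, rfl⟩))
  obtain ⟨l', hl', _, ⟨w', rfl⟩, hz'⟩ := Submodule.mem_sup.1 hy'
  obtain rfl : z = g y' + l' + h w' := by rw [add_assoc, hz']; abel
  refine ⟨y - h y', ?_⟩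
  simp only [map_add, map_sub, hh, hgh]
  convert add_mem hl (hhL l' hl') using 1
  abel

lemma ExactMod.sup_range {p : ℕ → V →ₗ[k] V} {N : ℕ} (hp : ∀ x, ∑ a ∈ Finset.range N, p a x = x)
    (hpp : ∀ a x, p a (p a x) = p a x) (hpL : ∀ a, ∀ x ∈ L, p a x ∈ L)
    (hpg : ∀ a x, p a (g x) = g (p a x)) (hph : ∀ a x, p (a + 1) (h x) = h (p a x))
    (hp0 : ∀ x, p 0 (h x) = 0) (hgL : ∀ x ∈ L, g x ∈ L) (hhL : ∀ x ∈ L, h x ∈ L)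
    (hg : ∀ x, g (g x) = 0) (hh : ∀ x, h (h x) = 0) (hgh : ∀ x, g (h x) = -h (g x))
    (eg : ExactMod k g L) (eh : ExactMod k h L) : ExactMod k g (L ⊔ LinearMap.range h) := by
  have key : ∀ a x, p a x = x → g x ∈ L ⊔ LinearMap.range h →
      x ∈ L ⊔ LinearMap.range g ⊔ LinearMap.range h := by
    intro a
    induction a with
    | zero =>
      intro x hx hgx
      obtain ⟨l, hl, _, ⟨y, rfl⟩, hy⟩ := Submodule.mem_sup.1 hgx
      have h0 : g x ∈ L := by
        have := hpL 0 l hl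
        rw [← hx, ← hpg, ← hy, map_add, hp0, add_zero]
        exact this
      obtain ⟨z, hz⟩ := eg x h0
      rw [← sub_add_cancel x (g z)]
      exact Submodule.mem_sup_left (add_mem (Submodule.mem_sup_left hz)
        (Submodule.mem_sup_right ⟨z, rfl⟩))
    | succ a ih =>
      intro x hx hgx
      obtain ⟨l, hl, _, ⟨y, rfl⟩, hy⟩ := Submodule.mem_sup.1 hgx
      have h1 : g x = p (a + 1) l + h (p a y) := by
        rw [← hph, ← map_add, hy, hpg, hx]
      have h2 : g x - h (p a y) ∈ L := by
        rw [h1, add_sub_cancel_right]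
        exact hpL _ _ hl
      have h3 : h (g (p a y)) ∈ L := by
        have := hgL _ h2
        rwa [map_sub, hg, zero_sub, hgh, neg_neg] at this
      obtain ⟨w, hw⟩ := eh _ h3
      have h4 := ih (p a y) (hpp a y) (by
        rw [← sub_add_cancel (g (p a y)) (h w)]
        exact add_mem (Submodule.mem_sup_left hw) (Submodule.mem_sup_right ⟨w, rfl⟩))
      obtain ⟨_, h5, _, ⟨β, rfl⟩, h6⟩ := Submodule.mem_sup.1 h4
      obtain ⟨l', hl', _, ⟨α, rfl⟩, rfl⟩ := Submodule.mem_sup.1 h5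
      rw [← h6] at h2
      simp only [map_add, hh, add_zero] at h2
      obtain ⟨v, hv⟩ := eg (x + h α) (by
        rw [map_add, hgh]
        convert add_mem h2 (hhL l' hl') using 1
        abel)
      rw [show x = (x + h α - g v) + g v + h (-α) by rw [map_neg]; abel]
      exact add_mem (add_mem (Submodule.mem_sup_left (Submodule.mem_sup_left hv))
        (Submodule.mem_sup_left (Submodule.mem_sup_right ⟨v, rfl⟩)))
        (Submodule.mem_sup_right ⟨-α, rfl⟩)
  intro x hx
  have hmem : x ∈ L ⊔ LinearMap.range g ⊔ LinearMap.range h := by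
    rw [← hp x]
    refine Submodule.sum_mem _ fun a _ => key a _ (hpp a x) ?_
    rw [← hpg]
    obtain ⟨l, hl, _, ⟨y, rfl⟩, hy⟩ := Submodule.mem_sup.1 hx
    rw [← hy, map_add]
    refine add_mem (Submodule.mem_sup_left (hpL a l hl)) (Submodule.mem_sup_right ?_)
    cases a with
    | zero => rw [hp0]; exact zero_mem _
    | succ a => exact ⟨_, (hph a y).symm⟩
  obtain ⟨_, h5, _, ⟨β, rfl⟩, rfl⟩ := Submodule.mem_sup.1 hmem
  obtain ⟨l', hl', _, ⟨α, rfl⟩, rfl⟩ := Submodule.mem_sup.1 h5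
  refine ⟨α, ?_⟩
  rw [add_right_comm, add_sub_cancel_right]
  exact add_mem (Submodule.mem_sup_left hl') (Submodule.mem_sup_right ⟨β, rfl⟩)

end ExactModulo

section AnticommutingFamily

variable {ι R : Type*} [CommRing R]

/-- The matrix `A` raises the degree `d` by `c`. -/
def IsHomogMatrix (d : ι → ℤ) (c : ℤ) (A : Matrix ι ι R) : Prop :=
  ∀ σ τ, A σ τ ≠ 0 → d σ = d τ + c

namespace IsHomogMatrix

variable {d : ι → ℤ} {a b : ℤ} {A B : Matrix ι ι R}

lemma mul [Fintype ι] (hA : IsHomogMatrix d a A) (hB : IsHomogMatrix d b B) :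
    IsHomogMatrix d (a + b) (A * B) := by
  intro σ τ h
  obtain ⟨ρ, -, hρ⟩ := Finset.exists_ne_zero_of_sum_ne_zero h
  rw [hA σ ρ (left_ne_zero_of_mul hρ), hB ρ τ (right_ne_zero_of_mul hρ)]
  ring

lemma add (hA : IsHomogMatrix d a A) (hB : IsHomogMatrix d a B) :
    IsHomogMatrix d a (A + B) := by
  intro σ τ h
  by_cases h0 : A σ τ = 0
  · exact hB σ τ fun h1 => h (by rw [Matrix.add_apply, h0, h1, add_zero])
  · exact hA σ τ h0

lemma zero : IsHomogMatrix d a (0 : Matrix ι ι R) := fun _ _ h => (h rfl).elim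

lemma sum {α : Type*} {s : Finset α} {A : α → Matrix ι ι R}
    (hA : ∀ i ∈ s, IsHomogMatrix d a (A i)) : IsHomogMatrix d a (∑ i ∈ s, A i) :=
  Finset.sum_induction _ _ (fun _ _ => add) zero hA

lemma smul (r : R) (hA : IsHomogMatrix d a A) : IsHomogMatrix d a (r • A) :=
  fun σ τ h => hA σ τ fun h0 => h (by rw [Matrix.smul_apply, h0, smul_zero])

lemma transpose (hA : IsHomogMatrix d a A) : IsHomogMatrix d (-a) A.transpose := by
  intro σ τ h
  rw [hA τ σ h]
  ring

lemma map {S : Type*} [CommRing S] (hA : IsHomogMatrix d a A) (φ : R →+* S) :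
    IsHomogMatrix d a (A.map φ) :=
  fun σ τ h => hA σ τ fun h0 => h (by rw [Matrix.map_apply, h0, map_zero])

lemma one [DecidableEq ι] : IsHomogMatrix d 0 (1 : Matrix ι ι R) := by
  intro σ τ h
  by_cases hστ : σ = τ
  · rw [hστ, add_zero]
  · exact (h (Matrix.one_apply_ne hστ)).elim

lemma pow [Fintype ι] [DecidableEq ι] (hA : IsHomogMatrix d a A) (t : ℕ) :
    IsHomogMatrix d (t * a) (A ^ t) := by
  induction t with
  | zero => simpa using one
  | succ t ih =>
    rw [pow_succ]
    convert ih.mul hA using 1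
    push_cast
    ring

/-- A matrix that raises a degree is nilpotent. -/
lemma isNilpotent [Fintype ι] [DecidableEq ι] (hA : IsHomogMatrix d 1 A) : IsNilpotent A := by
  obtain ⟨N, hN⟩ : ∃ N : ℕ, ∀ σ τ, d σ - d τ < N := by
    refine ⟨∑ σ, ∑ τ, (d σ - d τ).natAbs + 1, fun σ τ => ?_⟩
    have h1 : (d σ - d τ).natAbs ≤ ∑ σ, ∑ τ, (d σ - d τ).natAbs :=
      (Finset.single_le_sum (f := fun τ => (d σ - d τ).natAbs) (fun _ _ => Nat.zero_le _)
        (Finset.mem_univ τ)).trans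
        (Finset.single_le_sum (f := fun σ => ∑ τ, (d σ - d τ).natAbs) (fun _ _ => Nat.zero_le _)
        (Finset.mem_univ σ))
    omega
  refine ⟨N, ?_⟩
  ext σ τ
  by_contra h
  have := hA.pow N σ τ h
  have := hN σ τ
  omega

/-- The part of a matrix of degree `c`. -/
def part (d : ι → ℤ) (c : ℤ) (A : Matrix ι ι R) : Matrix ι ι R :=
  Matrix.of fun σ τ => if d σ = d τ + c then A σ τ else 0

lemma part_isHomogMatrix (c : ℤ) : IsHomogMatrix d c (part d c A) :=
  fun _ _ h => by_contra fun h0 => h (if_neg h0)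

lemma part_add (c : ℤ) : part d c (A + B) = part d c A + part d c B := by
  ext σ τ
  simp only [part, Matrix.of_apply, Matrix.add_apply]
  split_ifs <;> simp

lemma part_one [DecidableEq ι] : part d 0 (1 : Matrix ι ι R) = 1 := by
  ext σ τ
  simp only [part, Matrix.of_apply]
  split_ifs with h
  · rfl
  · exact (Matrix.one_apply_ne fun h' => h (by rw [h', add_zero])).symm

lemma part_apply (c : ℤ) (σ τ : ι) : part d c A σ τ = if d σ = d τ + c then A σ τ else 0 := rfl

lemma part_mul [Fintype ι] (hA : IsHomogMatrix d a A) (c : ℤ) :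
    part d (a + c) (A * B) = A * part d c B := by
  ext σ τ
  rw [part_apply, Matrix.mul_apply, Matrix.mul_apply]
  refine Eq.trans (b := ∑ ρ, if d σ = d τ + (a + c) then A σ ρ * B ρ τ else 0) ?_
    (Finset.sum_congr rfl fun ρ _ => ?_)
  · split_ifs <;> simp
  by_cases h : A σ ρ = 0
  · simp [h]
  · have := hA σ ρ h
    rw [part_apply, mul_ite, mul_zero]
    exact if_congr (by omega) rfl rfl

lemma part_mul' [Fintype ι] (hB : IsHomogMatrix d b B) (c : ℤ) :
    part d (c + b) (A * B) = part d c A * B := by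
  ext σ τ
  rw [part_apply, Matrix.mul_apply, Matrix.mul_apply]
  refine Eq.trans (b := ∑ ρ, if d σ = d τ + (c + b) then A σ ρ * B ρ τ else 0) ?_
    (Finset.sum_congr rfl fun ρ _ => ?_)
  · split_ifs <;> simp
  by_cases h : B ρ τ = 0
  · simp [h]
  · have := hB ρ τ h
    rw [part_apply, ite_mul, zero_mul]
    exact if_congr (by omega) rfl rfl

end IsHomogMatrix

/-- An anticommuting family of square zero matrices, the `j`-th of which is homogeneous for a
multigrading, of degree the `j`-th unit vector. -/
structure IsAnticommutingFamily [Fintype ι] (d : Fin m → ι → ℕ) (M : Fin m → Matrix ι ι k) :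
    Prop where
  mul_self : ∀ j, M j * M j = 0
  mul_eq_neg : ∀ i j, M i * M j = -(M j * M i)
  isHomogMatrix : ∀ l j, IsHomogMatrix (fun σ => (d l σ : ℤ)) (if l = j then 1 else 0) (M j)

namespace IsAnticommutingFamily

variable {k} {ι : Type*} [Fintype ι] {d : Fin m → ι → ℕ}
  {M : Fin m → Matrix ι ι k}

/-- The sum of the images of the first `t` matrices. -/
def imageSup (M : Fin m → Matrix ι ι k) (t : ℕ) : Submodule k (ι → k) :=
  ⨆ j : Fin m, ⨆ _ : (j : ℕ) < t, LinearMap.range (M j).mulVecLin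

lemma imageSup_succ (i : Fin m) :
    imageSup M (i + 1) = imageSup M i ⊔ LinearMap.range (M i).mulVecLin := by
  refine le_antisymm (iSup₂_le fun j hj => ?_) (sup_le (iSup₂_le fun j hj => ?_) ?_)
  · rcases (Nat.lt_succ_iff.1 hj).lt_or_eq with h | h
    · exact le_sup_of_le_left (le_iSup₂_of_le j h le_rfl)
    · rw [Fin.ext h]
      exact le_sup_right
  · exact le_iSup₂_of_le j (hj.trans (Nat.lt_succ_self _)) le_rfl
  · exact le_iSup₂_of_le i (Nat.lt_succ_self _) le_rfl

lemma imageSup_zero : imageSup M 0 = ⊥ := by simp [imageSup]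

lemma map_mem_imageSup {g : (ι → k) →ₗ[k] (ι → k)} {t : ℕ}
    (hg : ∀ j : Fin m, (j : ℕ) < t → ∀ x, g ((M j).mulVec x) ∈ imageSup M t) :
    ∀ x ∈ imageSup M t, g x ∈ imageSup M t := by
  change imageSup M t ≤ (imageSup M t).comap g
  refine iSup₂_le fun j hj => ?_
  rintro _ ⟨x, rfl⟩
  exact hg j hj x

lemma mulVec_mem_imageSup {j : Fin m} {t : ℕ} (h : (j : ℕ) < t) (x : ι → k) :
    (M j).mulVec x ∈ imageSup M t :=
  le_iSup₂_of_le (f := fun (j : Fin m) (_ : (j : ℕ) < t) => LinearMap.range (M j).mulVecLin)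
    j h le_rfl ⟨x, rfl⟩

lemma mulVec_self (hM : IsAnticommutingFamily k d M) (j : Fin m) (x : ι → k) :
    (M j).mulVec ((M j).mulVec x) = 0 := by
  rw [Matrix.mulVec_mulVec, hM.mul_self, Matrix.zero_mulVec]

lemma mulVec_eq_neg (hM : IsAnticommutingFamily k d M) (i j : Fin m) (x : ι → k) :
    (M i).mulVec ((M j).mulVec x) = -(M j).mulVec ((M i).mulVec x) := by
  rw [Matrix.mulVec_mulVec, hM.mul_eq_neg, Matrix.neg_mulVec, Matrix.mulVec_mulVec]

lemma mulVecLin_mem_imageSup (hM : IsAnticommutingFamily k d M) (i : Fin m) (t : ℕ) :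
    ∀ x ∈ imageSup M t, (M i).mulVecLin x ∈ imageSup M t :=
  map_mem_imageSup fun j hj x => by
    rw [Matrix.mulVecLin_apply, hM.mulVec_eq_neg, ← Matrix.mulVec_neg]
    exact mulVec_mem_imageSup hj _

lemma exactMod_of_le (hM : IsAnticommutingFamily k d M) {i : Fin m}
    (h : ∀ j : Fin m, ExactMod k (M j).mulVecLin (imageSup M j)) :
    ∀ t ≤ (i : ℕ), ExactMod k (M i).mulVecLin (imageSup M t) := by
  intro t ht
  induction ht using Nat.decreasingInduction with
  | self => exact h i
  | of_succ t ht ih =>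
    let j : Fin m := ⟨t, ht.trans i.2⟩
    have hs := imageSup_succ (M := M) j
    exact ExactMod.of_sup (hM.mulVecLin_mem_imageSup i t) (hM.mulVecLin_mem_imageSup j t)
      (hM.mulVec_self i) (hM.mulVec_self j) (hM.mulVec_eq_neg i j) (hs ▸ ih) (h j)

/-- The component of degree `a`. -/
def degProj {ι : Type*} (e : ι → ℕ) (a : ℕ) : (ι → k) →ₗ[k] (ι → k) :=
  LinearMap.pi fun σ => if e σ = a then LinearMap.proj σ else 0

lemma degProj_apply {ι : Type*} (e : ι → ℕ) (a : ℕ) (x : ι → k) (σ : ι) :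
    degProj e a x σ = if e σ = a then x σ else 0 := by
  rw [degProj, LinearMap.pi_apply]
  split_ifs <;> rfl

lemma degProj_degProj {ι : Type*} (e : ι → ℕ) (a : ℕ) (x : ι → k) :
    degProj e a (degProj e a x) = degProj e a x := by
  funext σ
  simp only [degProj_apply]
  split_ifs <;> rfl

lemma sum_degProj (e : ι → ℕ) (x : ι → k) :
    ∑ a ∈ Finset.range (Finset.univ.sup e + 1), degProj e a x = x := by
  funext σ
  rw [Finset.sum_apply]
  simp only [degProj_apply]
  rw [Finset.sum_ite_eq, if_pos]
  exact Finset.mem_range.2 (Nat.lt_succ_iff.2 (Finset.le_sup (Finset.mem_univ σ)))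

lemma degProj_mulVec {A : Matrix ι ι k} {e : ι → ℕ} {c : ℕ}
    (hA : IsHomogMatrix (fun σ => (e σ : ℤ)) c A) (a : ℕ) (x : ι → k) :
    degProj e (a + c) (A.mulVec x) = A.mulVec (degProj e a x) := by
  funext σ
  rw [degProj_apply]
  refine Eq.trans (b := ∑ τ, if e σ = a + c then A σ τ * x τ else 0) ?_
    (Finset.sum_congr rfl fun τ _ => ?_)
  · split_ifs
    · rfl
    · simp
  · by_cases h : A σ τ = 0
    · simp [h]
    · have h1 : (e σ : ℤ) = e τ + c := hA σ τ h
      have h2 := degProj_apply e a x τ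
      have h3 : (e σ = a + c) = (e τ = a) := propext (by omega)
      simp only [h2, mul_ite, mul_zero, h3]

lemma degProj_mulVec_eq_zero {A : Matrix ι ι k} {e : ι → ℕ} {c : ℕ}
    (hA : IsHomogMatrix (fun σ => (e σ : ℤ)) c A) {a : ℕ} (ha : a < c) (x : ι → k) :
    degProj e a (A.mulVec x) = 0 := by
  funext σ
  rw [degProj_apply]
  split_ifs with h
  · refine Finset.sum_eq_zero fun τ _ => ?_
    by_cases h0 : A σ τ = 0
    · simp [h0]
    · have h1 : (e σ : ℤ) = e τ + c := hA σ τ h0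
      omega
  · rfl

lemma exactMod_imageSup (hM : IsAnticommutingFamily k d M)
    (h : ∀ j : Fin m, ExactMod k (M j).mulVecLin ⊥) (t : ℕ) :
    ∀ i : Fin m, t ≤ i → ExactMod k (M i).mulVecLin (imageSup M t) := by
  induction t with
  | zero =>
    intro i _
    rw [imageSup_zero]
    exact h i
  | succ t ih =>
    intro i hi
    let j : Fin m := ⟨t, Nat.lt_of_succ_le hi |>.trans i.2⟩
    have hij : j ≠ i := fun h' => by
      have := congrArg Fin.val h'
      change t = i at this
      omega
    have hs := imageSup_succ (M := M) j
    have hj := hM.isHomogMatrix j j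
    have hl : ∀ l, l ≠ j → IsHomogMatrix (fun σ => (d j σ : ℤ)) 0 (M l) := fun l hl => by
      have := hM.isHomogMatrix j l
      rwa [if_neg hl.symm] at this
    rw [if_pos rfl] at hj
    refine hs ▸ ExactMod.sup_range (p := degProj (d j)) (sum_degProj _) (degProj_degProj _)
      (fun a => map_mem_imageSup fun l hlt x => ?_) (fun a x => degProj_mulVec (hl i hij.symm) a x)
      (fun a x => degProj_mulVec hj a x) (fun x => degProj_mulVec_eq_zero hj zero_lt_one x)
      (hM.mulVecLin_mem_imageSup i t) (hM.mulVecLin_mem_imageSup j t)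
      (hM.mulVec_self i) (hM.mulVec_self j) (hM.mulVec_eq_neg i j)
      (ih i (Nat.le_of_succ_le hi)) (ih j le_rfl)
    have hlj : l ≠ j := fun h' => by
      have := congrArg Fin.val h'
      change (l : ℕ) = t at this
      omega
    have : degProj (d j) a ((M l).mulVec x) = _ := degProj_mulVec (hl l hlj) a x
    rw [this]
    exact mulVec_mem_imageSup hlt _

lemma forall_exactMod_iff (hM : IsAnticommutingFamily k d M) :
    (∀ i, ExactMod k (M i).mulVecLin (imageSup M i)) ↔
      ∀ j, ExactMod k (M j).mulVecLin ⊥ :=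
  ⟨fun h j => by simpa [imageSup_zero] using hM.exactMod_of_le h 0 (Nat.zero_le j),
    fun h i => hM.exactMod_imageSup h i i le_rfl⟩

lemma transpose_mul (hM : IsAnticommutingFamily k d M) (i j : Fin m) :
    (M i).transpose * (M j).transpose = -((M j).transpose * (M i).transpose) := by
  rw [← Matrix.transpose_mul, ← Matrix.transpose_mul, hM.mul_eq_neg, Matrix.transpose_neg]

end IsAnticommutingFamily

end AnticommutingFamily

section Homotopy

variable {k} {ι : Type*} [Fintype ι] [DecidableEq ι]

lemma exists_generalizedInverse (M : Matrix ι ι k) : ∃ G : Matrix ι ι k, M * G * M = M := by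
  obtain ⟨g, hg⟩ := M.mulVecLin.rangeRestrict.exists_rightInverse_of_surjective
    (LinearMap.range_rangeRestrict _)
  obtain ⟨G, hG⟩ := LinearMap.exists_extend g
  refine ⟨LinearMap.toMatrix' G, ?_⟩
  apply Matrix.toLin'.injective
  ext1 i
  simp only [Matrix.toLin'_mul, Matrix.toLin'_toMatrix']
  ext1
  have h1 := LinearMap.congr_fun hg (M.mulVecLin.rangeRestrict (Pi.single i 1))
  have h2 := LinearMap.congr_fun hG (M.mulVecLin.rangeRestrict (Pi.single i 1))
  have h3 := congrArg Subtype.val h1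
  simp only [LinearMap.comp_apply, Matrix.toLin'_apply] at h2 ⊢
  change G (M.mulVec (Pi.single i 1)) = _ at h2
  change M.mulVec (G (M.mulVec (Pi.single i 1))) = _
  rw [h2]
  exact h3

lemma ExactMod.exists_homotopy {M : Matrix ι ι k} (hsq : M * M = 0)
    (hex : ExactMod k M.mulVecLin ⊥) {d : ι → ℤ} (hd : IsHomogMatrix d 1 M) :
    ∃ s, IsHomogMatrix d (-1) s ∧ M * s + s * M = 1 := by
  obtain ⟨G, hG⟩ := exists_generalizedInverse M
  have h1 : M * G * (1 - G * M) = 1 - G * M := by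
    apply Matrix.toLin'.injective
    ext1 i
    ext1
    obtain ⟨y, hy⟩ := hex ((1 - G * M).mulVec (Pi.single i 1)) (by
      rw [Submodule.mem_bot, Matrix.mulVecLin_apply, Matrix.mulVec_mulVec, mul_sub, mul_one,
        ← mul_assoc, hG, sub_self, Matrix.zero_mulVec])
    rw [Submodule.mem_bot, sub_eq_zero, Matrix.mulVecLin_apply] at hy
    change (M * G * (1 - G * M)).mulVec (Pi.single i 1) = (1 - G * M).mulVec (Pi.single i 1)
    rw [← Matrix.mulVec_mulVec, hy, Matrix.mulVec_mulVec, hG]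
  have h2 : M * (G * (1 - G * M)) + G * (1 - G * M) * M = 1 := by
    rw [← mul_assoc, h1, mul_assoc G, sub_mul, one_mul, mul_assoc G, hsq, mul_zero, sub_zero,
      sub_add_cancel]
  refine ⟨IsHomogMatrix.part d (-1) (G * (1 - G * M)), IsHomogMatrix.part_isHomogMatrix _, ?_⟩
  have h3 := congrArg (IsHomogMatrix.part d 0) h2
  rw [IsHomogMatrix.part_add, IsHomogMatrix.part_one] at h3
  rw [← hd.part_mul, ← hd.part_mul']
  exact h3

lemma exactMod_of_homotopy {M s : Matrix ι ι k} (h : M * s + s * M = 1) :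
    ExactMod k M.mulVecLin ⊥ := by
  intro x hx
  refine ⟨s.mulVec x, ?_⟩
  rw [Submodule.mem_bot, Matrix.mulVecLin_apply] at *
  have := congrArg (fun A => A.mulVec x) h
  simp only [Matrix.add_mulVec, ← Matrix.mulVec_mulVec, hx, Matrix.mulVec_zero, add_zero,
    Matrix.one_mulVec] at this
  rw [this, sub_self]

end Homotopy

section FiniteOfExact

variable {k} {ι R : Type*} [Fintype ι] [DecidableEq ι] [CommRing R] [Algebra k R]
  {d : Fin m → ι → ℕ} {M : Fin m → Matrix ι ι k}

lemma map_mul_map {ι : Type*} [Fintype ι] (A B : Matrix ι ι k) :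
    A.map (algebraMap k R) * B.map (algebraMap k R) = (A * B).map (algebraMap k R) :=
  (Matrix.map_mul (f := algebraMap k R)).symm

lemma deformedD_mul_self (hM : IsAnticommutingFamily k d M) (x : Fin m → R) :
    deformedD k x M * deformedD k x M = 0 := by
  rw [deformedD, Finset.sum_mul_sum, ← Finset.sum_product']
  refine Finset.sum_involution (fun p _ => p.swap) (fun p _ => ?_) (fun p _ h h' => h ?_)
    (fun _ _ => Finset.mem_univ _) (fun p _ => p.swap_swap)
  · simp only [Prod.fst_swap, Prod.snd_swap, smul_mul_smul_comm]
    rw [map_mul_map, map_mul_map, hM.transpose_mul, mul_comm (x p.2), ← smul_add,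
      ← Matrix.map_add _ (map_add _), neg_add_cancel, Matrix.map_zero _ (map_zero _), smul_zero]
  · obtain ⟨i, j⟩ := p
    obtain rfl : j = i := congrArg Prod.fst h'
    rw [smul_mul_smul_comm, map_mul_map, ← Matrix.transpose_mul, hM.mul_self,
      Matrix.transpose_zero, Matrix.map_zero _ (map_zero _), smul_zero]

lemma exists_pow_smul_mem (hM : IsAnticommutingFamily k d M) (x : Fin m → R) (j : Fin m)
    (hj : ExactMod k (M j).mulVecLin ⊥) :
    ∃ N : ℕ, ∀ z, (deformedD k x M).mulVec z = 0 →
      ∃ v, x j ^ N • z = (deformedD k x M).mulVec v := by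
  have hjj := hM.isHomogMatrix j j
  rw [if_pos rfl] at hjj
  obtain ⟨s, hs, hs1⟩ := ExactMod.exists_homotopy (hM.mul_self j) hj hjj
  have hDD := deformedD_mul_self hM x
  let e : ι → ℤ := fun σ => d j σ
  let D : Matrix ι ι R := deformedD k x M
  let S : Matrix ι ι R := s.transpose.map (algebraMap k R)
  have hS : IsHomogMatrix e 1 S := by
    have := hs.transpose.map (algebraMap k R)
    rwa [neg_neg] at this
  let A := D * S + S * D
  let B : Fin m → Matrix ι ι R := fun l => (M l).transpose.map (algebraMap k R)
  have hA : A = ∑ l, x l • (B l * S + S * B l) := by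
    simp only [A, D, deformedD, Finset.sum_mul, Finset.mul_sum, ← Finset.sum_add_distrib,
      smul_mul_assoc, mul_smul_comm, ← smul_add]
    rfl
  have hBj : B j * S + S * B j = 1 := by
    simp only [B, S, map_mul_map]
    rw [← Matrix.map_add _ (map_add _), ← Matrix.transpose_mul, ← Matrix.transpose_mul,
      ← Matrix.transpose_add, add_comm, hs1, Matrix.transpose_one,
      Matrix.map_one _ (map_zero _) (map_one _)]
  have hθ : IsHomogMatrix e 1 (x j • 1 - A) := by
    have : x j • 1 - A = (-1 : R) • ∑ l ∈ Finset.univ.erase j, x l • (B l * S + S * B l) := by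
      rw [hA, ← Finset.add_sum_erase _ _ (Finset.mem_univ j), hBj]
      module
    rw [this]
    refine (IsHomogMatrix.sum fun l hl => ((?_ : IsHomogMatrix e 1 (B l * S)).add ?_).smul _).smul _
    all_goals
      have hl' := hM.isHomogMatrix j l
      rw [if_neg (Finset.ne_of_mem_erase hl).symm] at hl'
      have hB : IsHomogMatrix e 0 (B l) := by
        have := hl'.transpose.map (algebraMap k R)
        rwa [neg_zero] at this
    · simpa using hB.mul hS
    · simpa using hS.mul hB
  obtain ⟨N, hN⟩ := hθ.isNilpotent
  have hAD : Commute A D := by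
    change (D * S + S * D) * D = D * (D * S + S * D)
    rw [add_mul, mul_add, mul_assoc S, ← mul_assoc D D, hDD, mul_zero, zero_mul, add_zero, zero_add,
      mul_assoc]
  have hxD : Commute (x j • (1 : Matrix ι ι R)) D := (Commute.one_left D).smul_left _
  have hxA : Commute (x j • (1 : Matrix ι ι R)) A := (Commute.one_left A).smul_left _
  let Q := ∑ i ∈ Finset.range N, (x j • (1 : Matrix ι ι R)) ^ i * (x j • 1 - A) ^ (N - 1 - i)
  have hQD : Commute Q D := Commute.sum_left _ _ _ fun i _ =>
    (hxD.pow_left i).mul_left ((hxD.sub_left hAD).pow_left _)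
  have hQ : Q * A = x j ^ N • 1 := by
    have := ((Commute.refl _).sub_right hxA).geom_sum₂_mul N
    rwa [hN, sub_zero, sub_sub_cancel, smul_pow, one_pow] at this
  refine ⟨N, fun z hz => ⟨Q.mulVec (S.mulVec z), ?_⟩⟩
  have hz' : A.mulVec z = D.mulVec (S.mulVec z) := by
    change (D * S + S * D).mulVec z = _
    rw [Matrix.add_mulVec, ← Matrix.mulVec_mulVec, ← Matrix.mulVec_mulVec]
    change _ + S.mulVec ((deformedD k x M).mulVec z) = _
    rw [hz, Matrix.mulVec_zero, add_zero]
  calc x j ^ N • z = (x j ^ N • (1 : Matrix ι ι R)).mulVec z := by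
        rw [Matrix.smul_mulVec, Matrix.one_mulVec]
    _ = Q.mulVec (D.mulVec (S.mulVec z)) := by rw [← hQ, ← Matrix.mulVec_mulVec, hz']
    _ = D.mulVec (Q.mulVec (S.mulVec z)) := by
        rw [Matrix.mulVec_mulVec, hQD.eq, ← Matrix.mulVec_mulVec]

end FiniteOfExact

section FiniteQuotient

lemma mem_closure_range_single (v : Fin m → ℤ) :
    v ∈ AddSubgroup.closure (Set.range fun j : Fin m => (Pi.single j 1 : Fin m → ℤ)) := by
  rw [← Finset.univ_sum_single v]
  refine AddSubgroup.sum_mem _ fun j _ => ?_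
  have : (Pi.single j (v j) : Fin m → ℤ) = v j • Pi.single j 1 := by
    rw [← Pi.single_smul, smul_eq_mul, mul_one]
  rw [this]
  exact AddSubgroup.zsmul_mem _ (AddSubgroup.subset_closure (Set.mem_range_self j)) _

lemma finite_quotient_laurentVar (N : Fin m → ℕ) :
    Module.Finite k (LaurentRing k m ⧸
      Ideal.span (Set.range fun j => laurentVar k j ^ N j)) := by
  set I := Ideal.span (Set.range fun j => laurentVar k j ^ N j) with hI
  let q : LaurentRing k m →ₐ[k] LaurentRing k m ⧸ I := Ideal.Quotient.mkₐ k I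
  have hnil : ∀ j, IsNilpotent (q (laurentVar k j)) := fun j => ⟨N j, by
    rw [← map_pow]
    exact Ideal.Quotient.eq_zero_iff_mem.2 (Ideal.subset_span ⟨j, rfl⟩)⟩
  have hint : ∀ x : LaurentRing k m ⧸ I, IsNilpotent x → IsIntegral k x := by
    rintro x ⟨t, ht⟩
    exact ⟨Polynomial.X ^ t, Polynomial.monic_X_pow t, by simp [ht]⟩
  have key : ∀ v : Fin m → ℤ, IsIntegral k (q (AddMonoidAlgebra.single v 1)) ∧
      IsIntegral k (q (AddMonoidAlgebra.single (-v) 1)) := by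
    intro v
    have hv := mem_closure_range_single v
    induction hv using AddSubgroup.closure_induction with
    | mem v hv =>
      obtain ⟨j, rfl⟩ := hv
      have h1 : (AddMonoidAlgebra.single (-Pi.single j 1) 1 : LaurentRing k m)
          = laurentVar k j + 1 := (sub_add_cancel _ _).symm
      have h2 : (AddMonoidAlgebra.single (Pi.single j 1) 1 : LaurentRing k m)
          = laurentVar k j * (-AddMonoidAlgebra.single (Pi.single j 1) 1) + 1 := by
        rw [laurentVar, sub_mul, mul_neg, AddMonoidAlgebra.single_mul_single, neg_add_cancel,
          one_mul, one_mul, ← AddMonoidAlgebra.one_def]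
        abel
      refine ⟨?_, ?_⟩
      · rw [h2, map_add, map_one, map_mul]
        exact (hint _ ((Commute.all _ _).isNilpotent_mul_right (hnil j))).add isIntegral_one
      · rw [h1, map_add, map_one]
        exact (hint _ (hnil j)).add isIntegral_one
    | zero =>
      rw [neg_zero, ← AddMonoidAlgebra.one_def, map_one]
      exact ⟨isIntegral_one, isIntegral_one⟩
    | add v w _ _ hv hw =>
      rw [neg_add, ← one_mul (1 : k), ← AddMonoidAlgebra.single_mul_single,
        ← AddMonoidAlgebra.single_mul_single, map_mul, map_mul]
      exact ⟨hv.1.mul hw.1, hv.2.mul hw.2⟩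
    | neg v _ hv => exact ⟨hv.2, (neg_neg v).symm ▸ hv.1⟩
  have hint : Algebra.IsIntegral k (LaurentRing k m ⧸ I) := ⟨fun x => by
    obtain ⟨r, rfl⟩ := Ideal.Quotient.mk_surjective x
    change IsIntegral k (q r)
    induction r using AddMonoidAlgebra.induction_linear with
    | zero => rw [map_zero]; exact isIntegral_zero
    | add r s hr hs => rw [map_add]; exact hr.add hs
    | single v c =>
      have : (AddMonoidAlgebra.single v c : LaurentRing k m)
          = c • AddMonoidAlgebra.single v 1 := by
        rw [AddMonoidAlgebra.smul_single, smul_eq_mul, mul_one]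
      rw [this, map_smul]
      exact (key v).1.smul c⟩
  have : Algebra.FiniteType k (LaurentRing k m) := inferInstance
  have : Algebra.FiniteType k (LaurentRing k m ⧸ I) := inferInstance
  exact Algebra.IsIntegral.finite

variable {k} {ι R : Type*} [Fintype ι] [CommRing R] [Algebra k R]
  {d : Fin m → ι → ℕ} {M : Fin m → Matrix ι ι k}

lemma HasFiniteHomology.of_ideal [IsNoetherianRing R] (D : Matrix ι ι R) (I : Ideal R)
    [hI : Module.Finite k (R ⧸ I)]
    (h : ∀ r ∈ I, ∀ z, D.mulVec z = 0 → ∃ v, r • z = D.mulVec v) : HasFiniteHomology k D := by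
  obtain ⟨s, hs⟩ : (LinearMap.ker D.mulVecLin).FG := IsNoetherian.noetherian _
  obtain ⟨g, hg⟩ := (Ideal.Quotient.mkₐ k I).toLinearMap.exists_rightInverse_of_surjective
    (LinearMap.range_eq_top.2 Ideal.Quotient.mk_surjective)
  let U : Submodule k (ι → R) := ⨆ b ∈ s, LinearMap.range
    (((LinearMap.toSpanSingleton R (ι → R) b).restrictScalars k).comp g)
  refine ⟨U, ?_, fun z hz => ?_⟩
  · refine Submodule.fg_biSup _ _ fun b _ => ?_
    rw [LinearMap.range_eq_map]
    exact hI.fg_top.map _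
  · have hz' : z ∈ Submodule.span R (s : Set (ι → R)) := by rw [hs]; exact hz
    have : z ∈ U ⊔ LinearMap.range (D.mulVecLin.restrictScalars k) := by
      obtain ⟨c, -, rfl⟩ := Submodule.mem_span_finset.1 hz'
      refine Submodule.sum_mem _ fun b hb => ?_
      have hb0 : D.mulVec b = 0 := by
        have : b ∈ LinearMap.ker D.mulVecLin := hs ▸ Submodule.subset_span hb
        exact this
      let w := g (Ideal.Quotient.mk I (c b))
      have hw : c b - w ∈ I := by
        rw [← Ideal.Quotient.eq_zero_iff_mem, map_sub, sub_eq_zero]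
        exact (LinearMap.congr_fun hg (Ideal.Quotient.mk I (c b))).symm
      obtain ⟨v, hv⟩ := h _ hw b hb0
      have hc : c b • b = w • b + (c b - w) • b := by rw [← add_smul, add_sub_cancel]
      rw [hc, hv]
      refine Submodule.add_mem_sup ?_ ⟨v, rfl⟩
      exact Submodule.mem_iSup_of_mem b (Submodule.mem_iSup_of_mem hb ⟨_, rfl⟩)
    obtain ⟨u, hu, _, ⟨v, rfl⟩, rfl⟩ := Submodule.mem_sup.1 this
    exact ⟨u, hu, v, rfl⟩

lemma hasFiniteHomology_of_exactMod [DecidableEq ι] (hM : IsAnticommutingFamily k d M)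
    (h : ∀ j, ExactMod k (M j).mulVecLin ⊥) :
    HasFiniteHomology k (deformedD k (laurentVar k) M) := by
  choose N hN using fun j => exists_pow_smul_mem hM (laurentVar k) j (h j)
  have := finite_quotient_laurentVar k N
  have hft : Algebra.FiniteType k (LaurentRing k m) := inferInstance
  have := Algebra.FiniteType.isNoetherianRing k (LaurentRing k m)
  refine HasFiniteHomology.of_ideal _ (Ideal.span (Set.range fun j => laurentVar k j ^ N j))
    fun r hr z hz => ?_
  induction hr using Submodule.span_induction with
  | mem r hr =>
    obtain ⟨j, rfl⟩ := hr
    exact hN j z hz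
  | zero => exact ⟨0, by rw [zero_smul, Matrix.mulVec_zero]⟩
  | add r s _ _ hr hs =>
    obtain ⟨v, hv⟩ := hr
    obtain ⟨w, hw⟩ := hs
    exact ⟨v + w, by rw [add_smul, hv, hw, Matrix.mulVec_add]⟩
  | smul a r _ hr =>
    obtain ⟨v, hv⟩ := hr
    exact ⟨a • v, by rw [smul_eq_mul, mul_smul, hv, Matrix.mulVec_smul]⟩

end FiniteQuotient

section HomologyModulo

variable {k} {R V : Type*} [CommRing R] [Algebra k R] [AddCommGroup V] [Module R V] [Module k V]
  [IsScalarTower k R V]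

/-- The homology of `D` modulo `N` is finite-dimensional over `k`. -/
def FiniteHomologyModulo (k : Type*) [Field k] {R V : Type*} [CommRing R] [AddCommGroup V]
    [Module R V] [Module k V] (D : V →ₗ[R] V) (N : Submodule R V) : Prop :=
  ∃ U : Submodule k V, U.FG ∧ ∀ z, D z ∈ N → ∃ u ∈ U, ∃ v, z - u - D v ∈ N

lemma FiniteHomologyModulo.sup {D : V →ₗ[R] V} (hD : ∀ z, D (D z) = 0) {N : Submodule R V}
    (hDN : ∀ z ∈ N, D z ∈ N) {x : R} (hx : ∀ z, x • z ∈ N → z ∈ N)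
    (h : FiniteHomologyModulo k D N) {N' : Submodule R V}
    (hN' : ∀ z, z ∈ N' ↔ ∃ w, z - x • w ∈ N) : FiniteHomologyModulo k D N' := by
  obtain ⟨U, hU, hUN⟩ := h
  let P : Submodule k V :=
    { carrier := {u | u ∈ U ∧ ∃ v, D v - x • u ∈ N}
      zero_mem' := ⟨zero_mem _, 0, by simp⟩
      add_mem' := by
        rintro a b ⟨ha, v, hv⟩ ⟨hb, w, hw⟩
        refine ⟨add_mem ha hb, v + w, ?_⟩
        rw [map_add, smul_add, add_sub_add_comm]
        exact add_mem hv hw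
      smul_mem' := by
        rintro c a ⟨ha, v, hv⟩
        refine ⟨U.smul_mem c ha, c • v, ?_⟩
        have h1 : D (c • v) - x • c • a = algebraMap k R c • (D v - x • a) := by
          rw [smul_sub, ← map_smul, smul_comm _ x, algebraMap_smul, algebraMap_smul]
        rw [h1]
        exact N.smul_mem _ hv }
  have hP : P.FG := Submodule.FG.of_le hU fun u hu => hu.1
  obtain ⟨Q, hQ, hPQ⟩ : ∃ Q : Submodule k V, Q.FG ∧ ∀ u ∈ P, ∃ v ∈ Q, D v - x • u ∈ N := by
    obtain ⟨s, hs⟩ := hP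
    have hsv : ∀ b : s, ∃ v, D v - x • (b : V) ∈ N := fun b =>
      (show (b : V) ∈ P from hs ▸ Submodule.subset_span b.2).2
    choose v hv using hsv
    refine ⟨Submodule.span k (Set.range v), Submodule.fg_span (Set.finite_range v), fun u hu => ?_⟩
    rw [← hs] at hu
    induction hu using Submodule.span_induction with
    | mem b hb => exact ⟨v ⟨b, hb⟩, Submodule.subset_span (Set.mem_range_self _), hv ⟨b, hb⟩⟩
    | zero => exact ⟨0, zero_mem _, by simp⟩
    | add a b _ _ ha hb =>
      obtain ⟨v, hvQ, hv⟩ := ha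
      obtain ⟨w, hwQ, hw⟩ := hb
      refine ⟨v + w, add_mem hvQ hwQ, ?_⟩
      rw [map_add, smul_add, add_sub_add_comm]
      exact add_mem hv hw
    | smul c a _ ha =>
      obtain ⟨v, hvQ, hv⟩ := ha
      refine ⟨c • v, Submodule.smul_mem _ c hvQ, ?_⟩
      have h1 : D (c • v) - x • c • a = algebraMap k R c • (D v - x • a) := by
        rw [smul_sub, ← map_smul, smul_comm _ x, algebraMap_smul, algebraMap_smul]
      rw [h1]
      exact N.smul_mem _ hv
  refine ⟨U ⊔ Q, hU.sup hQ, fun z hz => ?_⟩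
  obtain ⟨w, hw⟩ := (hN' _).1 hz
  have hDw : D w ∈ N := by
    refine hx _ ?_
    have := N.neg_mem (hDN _ hw)
    rwa [map_sub, hD, zero_sub, neg_neg, map_smul] at this
  obtain ⟨u', hu', v', hv'⟩ := hUN w hDw
  have h1 : D (z - x • v') - x • u' ∈ N := by
    have : D (z - x • v') - x • u' = (D z - x • w) + x • (w - u' - D v') := by
      rw [map_sub, map_smul]
      module
    rw [this]
    exact add_mem hw (N.smul_mem _ hv')
  obtain ⟨v, hvQ, hv⟩ := hPQ u' ⟨hu', _, h1⟩
  obtain ⟨u, hu, v'', hv''⟩ := hUN (z - x • v' - v) (by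
    have : D (z - x • v' - v) = (D (z - x • v') - x • u') - (D v - x • u') := by
      rw [map_sub D (z - x • v') v]
      abel
    rw [this]
    exact sub_mem h1 hv)
  refine ⟨u + v, Submodule.add_mem_sup hu hvQ, v'', (hN' _).2 ⟨v', ?_⟩⟩
  convert hv'' using 1
  abel

end HomologyModulo

section LaurentIdeal

/-- The endomorphism of `ℤᵐ` that replaces the coordinates in `S` by `0`. -/
def zeroCoords (S : Set (Fin m)) : (Fin m → ℤ) →+ (Fin m → ℤ) where
  toFun v l := if l ∈ S then 0 else v l
  map_zero' := by
    funext l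
    simp
  map_add' v w := by
    funext l
    simp only [Pi.add_apply]
    split_ifs <;> simp

lemma zeroCoords_single_of_mem {S : Set (Fin m)} {j : Fin m} (h : j ∈ S) (t : ℤ) :
    zeroCoords S (Pi.single j t) = 0 := by
  funext l
  change (if l ∈ S then 0 else _) = (0 : ℤ)
  split_ifs with hl
  · rfl
  · have hlj : l ≠ j := fun h' => hl (h' ▸ h)
    exact Pi.single_eq_of_ne hlj _

lemma zeroCoords_single_of_notMem {S : Set (Fin m)} {j : Fin m} (h : j ∉ S) (t : ℤ) :
    zeroCoords S (Pi.single j t) = Pi.single j t := by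
  funext l
  change (if l ∈ S then 0 else _) = (Pi.single j t : Fin m → ℤ) l
  split_ifs with hl
  · have hlj : l ≠ j := fun h' => h (h' ▸ hl)
    exact (Pi.single_eq_of_ne (M := fun _ => ℤ) hlj _).symm
  · rfl

/-- The endomorphism of the Laurent ring that specializes the variables in `S` to `1`. -/
def specialize (S : Set (Fin m)) : LaurentRing k m →ₐ[k] LaurentRing k m :=
  AddMonoidAlgebra.mapDomainAlgHom k k (zeroCoords S)

lemma specialize_single (S : Set (Fin m)) (v : Fin m → ℤ) (c : k) :
    specialize k S (AddMonoidAlgebra.single v c) = AddMonoidAlgebra.single (zeroCoords S v) c :=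
  AddMonoidAlgebra.mapDomain_single ..

lemma specialize_laurentVar_of_mem {S : Set (Fin m)} {j : Fin m} (h : j ∈ S) :
    specialize k S (laurentVar k j) = 0 := by
  rw [laurentVar, map_sub, specialize_single, map_neg, zeroCoords_single_of_mem h, neg_zero,
    map_one, ← AddMonoidAlgebra.one_def, sub_self]

lemma specialize_laurentVar_of_notMem {S : Set (Fin m)} {j : Fin m} (h : j ∉ S) :
    specialize k S (laurentVar k j) = laurentVar k j := by
  rw [laurentVar, map_sub, specialize_single, map_neg, zeroCoords_single_of_notMem h, map_one]

lemma laurentVar_ne_zero (j : Fin m) : laurentVar k j ≠ 0 := by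
  rw [laurentVar, sub_ne_zero, AddMonoidAlgebra.one_def]
  intro h
  have := (AddMonoidAlgebra.single_left_inj (one_ne_zero (α := k))).1 h
  have := congrFun this j
  simp at this

/-- The ideal of the Laurent ring generated by the variables in `S`. -/
def laurentIdeal (S : Set (Fin m)) : Ideal (LaurentRing k m) := Ideal.span (laurentVar k '' S)

lemma sub_specialize_mem (S : Set (Fin m)) (r : LaurentRing k m) :
    r - specialize k S r ∈ laurentIdeal k S := by
  have key : ∀ v : Fin m → ℤ, Ideal.Quotient.mk (laurentIdeal k S) (AddMonoidAlgebra.single v 1) =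
      Ideal.Quotient.mk (laurentIdeal k S) (AddMonoidAlgebra.single (zeroCoords S v) 1) := by
    intro v
    have hv := mem_closure_range_single v
    have hadd : ∀ v w : Fin m → ℤ, Ideal.Quotient.mk (laurentIdeal k S)
        (AddMonoidAlgebra.single (v + w) 1) =
        Ideal.Quotient.mk (laurentIdeal k S) (AddMonoidAlgebra.single v 1) *
        Ideal.Quotient.mk (laurentIdeal k S) (AddMonoidAlgebra.single w 1) := fun v w => by
      rw [← map_mul, AddMonoidAlgebra.single_mul_single, one_mul]
    have hzero : Ideal.Quotient.mk (laurentIdeal k S) (AddMonoidAlgebra.single 0 1) = 1 :=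
      map_one _
    have hneg : ∀ v w : Fin m → ℤ, Ideal.Quotient.mk (laurentIdeal k S)
        (AddMonoidAlgebra.single v 1) =
        Ideal.Quotient.mk (laurentIdeal k S) (AddMonoidAlgebra.single w 1) →
        Ideal.Quotient.mk (laurentIdeal k S) (AddMonoidAlgebra.single (-v) 1) =
        Ideal.Quotient.mk (laurentIdeal k S) (AddMonoidAlgebra.single (-w) 1) := by
      intro v w h
      rw [← mul_one (Ideal.Quotient.mk _ (AddMonoidAlgebra.single (-v) 1)), ← hzero,
        ← add_neg_cancel w, hadd, ← mul_assoc, ← h, ← hadd, neg_add_cancel, hzero, one_mul]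
    induction hv using AddSubgroup.closure_induction with
    | mem v hv =>
      obtain ⟨j, rfl⟩ := hv
      by_cases hj : j ∈ S
      · have h1 : Ideal.Quotient.mk (laurentIdeal k S)
            (AddMonoidAlgebra.single (-Pi.single j 1) 1) =
            Ideal.Quotient.mk (laurentIdeal k S) (AddMonoidAlgebra.single 0 1) :=
          (Ideal.Quotient.mk_eq_mk_iff_sub_mem _ _).2
            (Ideal.subset_span (Set.mem_image_of_mem _ hj))
        have := hneg _ _ h1
        rw [neg_neg, neg_zero] at this
        rw [zeroCoords_single_of_mem hj, this]
      · rw [zeroCoords_single_of_notMem hj]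
    | zero => rw [map_zero]
    | add v w _ _ hv hw => rw [map_add, hadd, hadd, hv, hw]
    | neg v _ hv => rw [map_neg, hneg _ _ hv]
  induction r using AddMonoidAlgebra.induction_linear with
  | zero => rw [map_zero, sub_zero]; exact zero_mem _
  | add r s hr hs =>
    rw [map_add, add_sub_add_comm]
    exact add_mem hr hs
  | single v c =>
    have h := (Ideal.Quotient.mk_eq_mk_iff_sub_mem _ _).1 (key v)
    have := (laurentIdeal k S).mul_mem_left (AddMonoidAlgebra.single 0 c) h
    rw [mul_sub, AddMonoidAlgebra.single_mul_single, AddMonoidAlgebra.single_mul_single, zero_add,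
      zero_add, mul_one] at this
    rwa [specialize_single]

lemma mem_laurentIdeal_iff {S : Set (Fin m)} {r : LaurentRing k m} :
    r ∈ laurentIdeal k S ↔ specialize k S r = 0 := by
  constructor
  · intro h
    have : laurentIdeal k S ≤ RingHom.ker (specialize k S) := by
      refine Ideal.span_le.2 ?_
      rintro _ ⟨j, hj, rfl⟩
      exact specialize_laurentVar_of_mem k hj
    exact this h
  · intro h
    have := sub_specialize_mem k S r
    rwa [h, sub_zero] at this

lemma mem_laurentIdeal_of_mul_mem {S : Set (Fin m)} {j : Fin m} (hj : j ∉ S) {r : LaurentRing k m}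
    (h : laurentVar k j * r ∈ laurentIdeal k S) : r ∈ laurentIdeal k S := by
  rw [mem_laurentIdeal_iff, map_mul, specialize_laurentVar_of_notMem k hj] at h
  exact (mem_laurentIdeal_iff k).2 ((mul_eq_zero.1 h).resolve_left (laurentVar_ne_zero k j))

lemma mem_laurentIdeal_insert {S : Set (Fin m)} {j : Fin m} {r : LaurentRing k m} :
    r ∈ laurentIdeal k (insert j S) ↔ ∃ w, r - laurentVar k j * w ∈ laurentIdeal k S := by
  rw [laurentIdeal, Set.image_insert_eq, Ideal.mem_span_insert]
  constructor
  · rintro ⟨a, z, hz, rfl⟩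
    refine ⟨a, ?_⟩
    rwa [mul_comm a, add_sub_cancel_left]
  · rintro ⟨w, hw⟩
    exact ⟨w, _, hw, by ring⟩

end LaurentIdeal

section ExactOfFinite

variable {k} {ι : Type*} [Fintype ι] {d : Fin m → ι → ℕ} {M : Fin m → Matrix ι ι k}

/-- The submodule of vectors with entries in `I`. -/
def entriesIn {ι R : Type*} [CommRing R] (I : Ideal R) : Submodule R (ι → R) :=
  Submodule.pi Set.univ fun _ => I

lemma mem_entriesIn {ι R : Type*} [CommRing R] {I : Ideal R} {z : ι → R} :
    z ∈ entriesIn I ↔ ∀ σ, z σ ∈ I := by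
  simp [entriesIn, Submodule.mem_pi]

lemma mulVec_mem_entriesIn {R : Type*} [CommRing R] {I : Ideal R} (D : Matrix ι ι R) {z : ι → R}
    (hz : z ∈ entriesIn I) : D.mulVec z ∈ entriesIn I :=
  mem_entriesIn.2 fun _ => Ideal.sum_mem _ fun τ _ => I.mul_mem_left _ (mem_entriesIn.1 hz τ)

lemma finiteHomologyModulo_laurentIdeal (hM : IsAnticommutingFamily k d M)
    (h : HasFiniteHomology k (deformedD k (laurentVar k) M)) (S : Finset (Fin m)) :
    FiniteHomologyModulo k (deformedD k (laurentVar k) M).mulVecLin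
      (entriesIn (laurentIdeal k (S : Set (Fin m)))) := by
  induction S using Finset.induction_on with
  | empty =>
    obtain ⟨U, hU, hz⟩ := h
    have hbot : entriesIn (ι := ι) (laurentIdeal k ((∅ : Finset (Fin m)) : Set (Fin m))) = ⊥ := by
      ext z
      rw [mem_entriesIn, laurentIdeal, Finset.coe_empty, Set.image_empty, Ideal.span_empty,
        Submodule.mem_bot]
      exact ⟨fun h => funext h, fun h => congrFun h⟩
    refine ⟨U, hU, fun z h0 => ?_⟩
    rw [hbot, Submodule.mem_bot] at h0
    obtain ⟨u, hu, v, hv⟩ := hz z h0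
    refine ⟨u, hu, v, ?_⟩
    rw [hv, hbot, Submodule.mem_bot, Matrix.mulVecLin_apply]
    abel
  | insert j S hj ih =>
    have hj' : j ∉ (S : Set (Fin m)) := hj
    refine ih.sup (x := laurentVar k j) (fun z => ?_) (fun z hz => mulVec_mem_entriesIn _ hz)
      (fun z hz => ?_) fun z => ?_
    · rw [Matrix.mulVecLin_apply, Matrix.mulVecLin_apply, Matrix.mulVec_mulVec,
        deformedD_mul_self hM, Matrix.zero_mulVec]
    · exact mem_entriesIn.2 fun σ => mem_laurentIdeal_of_mul_mem k hj' (mem_entriesIn.1 hz σ)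
    · rw [Finset.coe_insert, mem_entriesIn]
      simp only [mem_laurentIdeal_insert]
      constructor
      · intro h
        choose w hw using h
        exact ⟨w, mem_entriesIn.2 hw⟩
      · rintro ⟨w, hw⟩ σ
        exact ⟨w σ, mem_entriesIn.1 hw σ⟩

lemma deformedD_mulVec_apply {R : Type*} [CommRing R] [Algebra k R] (x : Fin m → R) (z : ι → R)
    (σ : ι) : (deformedD k x M).mulVec z σ = ∑ j, x j * ∑ τ, algebraMap k R (M j τ σ) * z τ := by
  rw [deformedD, Matrix.sum_mulVec, Finset.sum_apply]
  refine Finset.sum_congr rfl fun j _ => ?_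
  rw [Matrix.smul_mulVec]
  rfl

lemma specialize_mulVec_apply (x : Fin m → LaurentRing k m) (S : Set (Fin m))
    (z : ι → LaurentRing k m) (σ : ι) :
    specialize k S ((deformedD k x M).mulVec z σ) =
      ∑ j, specialize k S (x j) * ∑ τ, algebraMap k _ (M j τ σ) * specialize k S (z τ) := by
  rw [deformedD_mulVec_apply]
  simp only [map_sum, map_mul, AlgHom.commutes]

variable (k) in
/-- The inclusion of the Laurent polynomials in the variable `j`. -/
def laurentLine (j : Fin m) : (ℤ →₀ k) →ₗ[k] LaurentRing k m :=
  Finsupp.lsum k fun t => (AddMonoidAlgebra.lsingle (Pi.single j t) : k →ₗ[k] LaurentRing k m)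

lemma laurentLine_single (j : Fin m) (t : ℤ) (c : k) :
    laurentLine k j (Finsupp.single t c) = AddMonoidAlgebra.single (Pi.single j t) c := by
  rw [laurentLine, Finsupp.lsum_single]
  rfl

lemma specialize_laurentLine {S : Set (Fin m)} {j : Fin m} (hj : j ∉ S) (p : ℤ →₀ k) :
    specialize k S (laurentLine k j p) = laurentLine k j p := by
  induction p using Finsupp.induction_linear with
  | zero => simp
  | add p q hp hq => rw [map_add, map_add, hp, hq]
  | single t c => rw [laurentLine_single, specialize_single, zeroCoords_single_of_notMem hj]

lemma coeff_laurentLine (j : Fin m) (p : ℤ →₀ k) (t : ℤ) :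
    (laurentLine k j p).coeff (Pi.single j t) = p t := by
  induction p using Finsupp.induction_linear with
  | zero => simp
  | add p q hp hq => rw [map_add, AddMonoidAlgebra.coeff_add, Finsupp.add_apply, hp, hq,
      Finsupp.add_apply]
  | single s c =>
    rw [laurentLine_single, AddMonoidAlgebra.coeff_single, Finsupp.single_apply,
      Finsupp.single_apply]
    exact if_congr (Pi.single_injective j).eq_iff rfl rfl

lemma exactMod_transpose_of_hasFiniteHomology (hM : IsAnticommutingFamily k d M)
    (h : HasFiniteHomology k (deformedD k (laurentVar k) M)) (j : Fin m) :
    ExactMod k (M j).transpose.mulVecLin ⊥ := by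
  intro c hc
  rw [Submodule.mem_bot, Matrix.mulVecLin_apply] at hc
  let S : Finset (Fin m) := Finset.univ.erase j
  have hjS : j ∉ (S : Set (Fin m)) := fun h => (Finset.mem_erase.1 h).1 rfl
  have hlS : ∀ l, l ≠ j → l ∈ (S : Set (Fin m)) := fun l hl =>
    Finset.mem_erase.2 ⟨hl, Finset.mem_univ l⟩
  obtain ⟨U, hU, hz⟩ := finiteHomologyModulo_laurentIdeal hM h S
  let C : LaurentRing k m →ₗ[k] (ι → LaurentRing k m) := LinearMap.pi fun σ => c σ • LinearMap.id
  have hC : ∀ r σ, C r σ = c σ • r := fun _ _ => rfl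
  have hDC : ∀ r, (deformedD k (laurentVar k) M).mulVecLin (C r) ∈
      entriesIn (laurentIdeal k (S : Set (Fin m))) := fun r => mem_entriesIn.2 fun σ => by
    rw [Matrix.mulVecLin_apply, deformedD_mulVec_apply]
    refine Ideal.sum_mem _ fun l _ => ?_
    by_cases hl : l = j
    · subst hl
      have h1 : ∑ τ, algebraMap k (LaurentRing k m) (M l τ σ) * C r τ =
          ((M l).transpose.mulVec c σ) • r := by
        have h2 : (M l).transpose.mulVec c σ = ∑ τ, M l τ σ * c τ := rfl
        rw [h2, Finset.sum_smul]
        refine Finset.sum_congr rfl fun τ _ => ?_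
        rw [hC, mul_smul, Algebra.smul_def (M l τ σ)]
      rw [h1, hc, Pi.zero_apply, zero_smul, mul_zero]
      exact zero_mem _
    · exact Ideal.mul_mem_right _ _ (Ideal.subset_span (Set.mem_image_of_mem _ (hlS l hl)))
  let W : Submodule k (ι → LaurentRing k m) :=
    LinearMap.range ((deformedD k (laurentVar k) M).mulVecLin.restrictScalars k) ⊔
      (entriesIn (laurentIdeal k (S : Set (Fin m)))).restrictScalars k
  let ρ := laurentLine k j
  have hninj : ¬ Function.Injective (W.mkQ ∘ₗ C ∘ₗ ρ) := by
    intro hinj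
    have : Module.Finite k (U.map W.mkQ) := Module.Finite.iff_fg.2 (hU.map _)
    have hmem : ∀ p, (W.mkQ ∘ₗ C ∘ₗ ρ) p ∈ U.map W.mkQ := fun p => by
      obtain ⟨u, hu, v, hv⟩ := hz _ (hDC (ρ p))
      refine ⟨u, hu, ?_⟩
      refine ((Submodule.Quotient.eq W).2 ?_).symm
      have : C (ρ p) - u = (deformedD k (laurentVar k) M).mulVecLin v +
        (C (ρ p) - u - (deformedD k (laurentVar k) M).mulVecLin v) := by abel
      rw [LinearMap.comp_apply, this]
      exact Submodule.add_mem_sup ⟨v, rfl⟩ hv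
    have hfin : Module.Finite k (ℤ →₀ k) := Module.Finite.of_injective
      (LinearMap.codRestrict (U.map W.mkQ) _ hmem) fun a b hab => hinj (congrArg Subtype.val hab)
    rcases Module.finite_finsupp_self_iff.1 hfin with h | h
    · exact not_subsingleton k h
    · exact not_finite ℤ
  obtain ⟨p, hp, hp0⟩ : ∃ p, (W.mkQ ∘ₗ C ∘ₗ ρ) p = 0 ∧ p ≠ 0 := by
    by_contra! hcon
    exact hninj ((injective_iff_map_eq_zero _).2 hcon)
  obtain ⟨_, ⟨v, rfl⟩, i, hi, hvi⟩ := Submodule.mem_sup.1 ((Submodule.Quotient.mk_eq_zero W).1 hp)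
  have hval : ∀ σ, c σ • ρ p = ∑ τ, M j τ σ •
      (laurentVar k j * specialize k (S : Set (Fin m)) (v τ)) := fun σ => by
    have h1 := congrArg (specialize k (S : Set (Fin m))) (congrFun hvi σ)
    have h2 : specialize k (S : Set (Fin m)) (i σ) = 0 :=
      (mem_laurentIdeal_iff k).1 (mem_entriesIn.1 hi σ)
    rw [Pi.add_apply, map_add, h2, add_zero] at h1
    have h3 : specialize k (S : Set (Fin m)) (C (ρ p) σ) = c σ • ρ p := by
      rw [hC, map_smul, specialize_laurentLine hjS]
    refine h3.symm.trans (h1.symm.trans ((specialize_mulVec_apply _ _ _ _).trans ?_))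
    rw [Finset.sum_eq_single j, specialize_laurentVar_of_notMem k hjS, Finset.mul_sum]
    · refine Finset.sum_congr rfl fun τ _ => ?_
      rw [Algebra.smul_def]
      ring
    · intro l _ hl
      rw [specialize_laurentVar_of_mem k (hlS l hl), zero_mul]
    · exact fun h => (h (Finset.mem_univ j)).elim
  obtain ⟨t, ht⟩ := Finsupp.ne_iff.1 hp0
  rw [Finsupp.zero_apply] at ht
  let w : ι → k := fun τ =>
    (laurentVar k j * specialize k (S : Set (Fin m)) (v τ)).coeff (Pi.single j t)
  have hw : p t • c = (M j).transpose.mulVec w := by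
    funext σ
    have h1 := congrArg (fun r : LaurentRing k m => r.coeff (Pi.single j t)) (hval σ)
    simp only [AddMonoidAlgebra.coeff_sum, AddMonoidAlgebra.coeff_smul, Finsupp.smul_apply,
      Finsupp.finsetSum_apply, ρ, coeff_laurentLine] at h1
    rw [Pi.smul_apply, smul_eq_mul, mul_comm]
    exact h1
  refine ⟨(p t)⁻¹ • w, ?_⟩
  rw [Submodule.mem_bot, Matrix.mulVecLin_apply, Matrix.mulVec_smul, ← hw, inv_smul_smul₀ ht,
    sub_self]

lemma exactMod_of_hasFiniteHomology (hM : IsAnticommutingFamily k d M)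
    (h : HasFiniteHomology k (deformedD k (laurentVar k) M)) (j : Fin m) :
    ExactMod k (M j).mulVecLin ⊥ := by
  have hjj := hM.isHomogMatrix j j
  rw [if_pos rfl] at hjj
  have hsq : (M j).transpose * (M j).transpose = 0 := by
    rw [← Matrix.transpose_mul, hM.mul_self, Matrix.transpose_zero]
  obtain ⟨s, -, hs⟩ := (exactMod_transpose_of_hasFiniteHomology hM h j).exists_homotopy hsq
    (d := fun σ => -(d j σ : ℤ)) fun σ τ hστ => by
      have h1 : (d j τ : ℤ) = d j σ + 1 := hjj τ σ hστ
      change -(d j σ : ℤ) = -(d j τ : ℤ) + 1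
      omega
  refine exactMod_of_homotopy (s := s.transpose) ?_
  rw [← Matrix.transpose_inj, Matrix.transpose_add, Matrix.transpose_mul, Matrix.transpose_mul,
    Matrix.transpose_transpose, Matrix.transpose_one, add_comm, hs]

lemma hasFiniteHomology_iff_exactMod (hM : IsAnticommutingFamily k d M) :
    HasFiniteHomology k (deformedD k (laurentVar k) M) ↔
      ∀ i, ExactMod k (M i).mulVecLin (IsAnticommutingFamily.imageSup M i) :=
  ⟨fun h => hM.forall_exactMod_iff.2 (exactMod_of_hasFiniteHomology hM h),
    fun h => hasFiniteHomology_of_exactMod hM (hM.forall_exactMod_iff.1 h)⟩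

end ExactOfFinite

section ExteriorMonomials

variable {k} {n : ℕ}

/-- A subspace stable under multiplication by the generators is stable under the whole exterior
algebra. -/
lemma ExteriorAlgebra.smul_mem_of_forall_single {M : Type*} [AddCommGroup M] [Module k M]
    [Module (ExteriorAlgebra k (Fin n → k)) M] [IsScalarTower k (ExteriorAlgebra k (Fin n → k)) M]
    {W : Submodule k M} (hW : ∀ i, ∀ x ∈ W,
      ExteriorAlgebra.ι k (Pi.single i 1 : Fin n → k) • x ∈ W)
    (a : ExteriorAlgebra k (Fin n → k)) : ∀ x ∈ W, a • x ∈ W := by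
  induction a using ExteriorAlgebra.induction with
  | algebraMap r =>
    intro x hx
    rw [algebraMap_smul]
    exact W.smul_mem r hx
  | ι v =>
    intro x hx
    rw [← Finset.univ_sum_single v, map_sum, Finset.sum_smul]
    refine W.sum_mem fun i _ => ?_
    rw [← mul_one (v i), ← smul_eq_mul, Pi.single_smul, map_smul, smul_assoc]
    exact W.smul_mem _ (hW i x hx)
  | mul a b ha hb =>
    intro x hx
    rw [mul_smul]
    exact ha _ (hb x hx)
  | add a b ha hb =>
    intro x hx
    rw [add_smul]
    exact W.add_mem (ha x hx) (hb x hx)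

lemma extMonomial_empty : extMonomial k (∅ : Finset (Fin n)) = 1 := by simp [extMonomial]

lemma extMonomial_insert_of_forall_lt {i : Fin n} {σ : Finset (Fin n)} (h : ∀ j ∈ σ, i < j) :
    extMonomial k (insert i σ) = ExteriorAlgebra.ι k (Pi.single i 1) * extMonomial k σ := by
  rw [extMonomial, Finset.sort_insert _ (fun j hj => (h j hj).le) fun hi => (h i hi).false]
  simp [extMonomial]

/-- Multiplying an exterior monomial by a generator. -/
lemma ι_mul_extMonomial (i : Fin n) (σ : Finset (Fin n)) :
    ExteriorAlgebra.ι k (Pi.single i 1) * extMonomial k σ =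
      if i ∈ σ then 0 else (koszulSign i σ : k) • extMonomial k (insert i σ) := by
  induction σ using Finset.induction_on_min with
  | empty => simp [extMonomial, koszulSign]
  | insert a σ ha ih =>
    have haσ : a ∉ σ := fun h => (ha a h).false
    rcases lt_trichotomy i a with hi | rfl | hi
    · have hlt : ∀ j ∈ insert a σ, i < j := by
        simpa [hi] using fun j hj => hi.trans (ha j hj)
      rw [if_neg fun h => (hlt i h).false, extMonomial_insert_of_forall_lt hlt,
        koszulSign_of_forall_ge fun j hj => (hlt j hj).le]
      simp
    · rw [extMonomial_insert_of_forall_lt ha, ← mul_assoc, ExteriorAlgebra.ι_sq_zero, zero_mul,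
        if_pos (Finset.mem_insert_self _ _)]
    · rw [extMonomial_insert_of_forall_lt ha, ← mul_assoc,
        eq_neg_of_add_eq_zero_left (ExteriorAlgebra.ι_add_mul_swap _ _), neg_mul, mul_assoc, ih]
      by_cases his : i ∈ σ
      · simp [his]
      · have hlt : ∀ j ∈ insert i σ, a < j := by simpa [hi] using ha
        rw [if_neg his, if_neg (by simp [his, hi.ne']), mul_smul_comm,
          ← extMonomial_insert_of_forall_lt hlt, koszulSign_insert_of_gt hi haσ,
          Finset.insert_comm]
        simp

lemma top_le_span_extMonomial :
    ⊤ ≤ Submodule.span k (Set.range (extMonomial k (n := n))) := by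
  intro x _
  rw [← mul_one x, ← smul_eq_mul]
  refine ExteriorAlgebra.smul_mem_of_forall_single (fun i y hy => ?_) x _
    (Submodule.subset_span ⟨∅, extMonomial_empty⟩)
  induction hy using Submodule.span_induction with
  | mem y hy =>
    obtain ⟨σ, rfl⟩ := hy
    rw [smul_eq_mul, ι_mul_extMonomial]
    split_ifs
    · exact zero_mem _
    · exact Submodule.smul_mem _ _ (Submodule.subset_span ⟨_, rfl⟩)
  | zero => simp
  | add y z _ _ hy hz => rw [smul_add]; exact add_mem hy hz
  | smul r y _ hy => rw [smul_comm]; exact Submodule.smul_mem _ r hy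

variable (k n) in
/-- The exterior monomials form a basis of the exterior algebra. -/
def extBasis : Module.Basis (Finset (Fin n)) k (ExteriorAlgebra k (Fin n → k)) :=
  basisOfTopLeSpanOfCardEqFinrank (extMonomial k) top_le_span_extMonomial
    (Module.finrank_eq_card_basis (Pi.basisFun k (Fin n)).ExteriorAlgebra).symm

lemma extBasis_apply (σ : Finset (Fin n)) : extBasis k n σ = extMonomial k σ := by
  simp [extBasis]

lemma extSRIdeal_le_span {K : Set (Finset (Fin n))} (hK : ∀ σ ∈ K, ∀ τ ⊆ σ, τ ∈ K)
    {x : ExteriorAlgebra k (Fin n → k)} (hx : x ∈ extSRIdeal k K) :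
    x ∈ Submodule.span k (extBasis k n '' Kᶜ) := by
  induction hx using Submodule.span_induction with
  | mem x hx =>
    obtain ⟨σ, hσ, rfl⟩ := hx
    exact Submodule.subset_span ⟨σ, hσ, extBasis_apply σ⟩
  | zero => exact zero_mem _
  | add x y _ _ hx hy => exact add_mem hx hy
  | smul a x _ hx =>
    refine ExteriorAlgebra.smul_mem_of_forall_single (fun i y hy => ?_) a x hx
    induction hy using Submodule.span_induction with
    | mem y hy =>
      obtain ⟨σ, hσ, rfl⟩ := hy
      rw [smul_eq_mul, extBasis_apply, ι_mul_extMonomial]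
      split_ifs
      · exact zero_mem _
      · exact Submodule.smul_mem _ _ (Submodule.subset_span
          ⟨insert i σ, fun h => hσ (hK _ h _ (Finset.subset_insert i σ)), extBasis_apply _⟩)
    | zero => simp
    | add y z _ _ hy hz => rw [smul_add]; exact add_mem hy hz
    | smul r y _ hy => rw [smul_comm]; exact Submodule.smul_mem _ r hy

end ExteriorMonomials

section StanleyReisner

variable {k} {n : ℕ} {Γ : SimpleGraph (Fin n)} {f : Fin n → Fin m}

variable (k Γ) in
/-- The exterior Stanley–Reisner ring in the basis of exterior monomials of cliques. -/
def cliqueMap : (Clique Γ → k) →ₗ[k]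
    ExteriorAlgebra k (Fin n → k) ⧸ extSRIdeal k (cliqueComplex Γ) :=
  ((extSRIdeal k (cliqueComplex Γ)).mkQ.restrictScalars k) ∘ₗ
    Fintype.linearCombination k fun σ : Clique Γ => extMonomial k σ.1

lemma cliqueMap_apply (w : Clique Γ → k) :
    cliqueMap k Γ w = (extSRIdeal k (cliqueComplex Γ)).mkQ (∑ σ, w σ • extMonomial k σ.1) := rfl

lemma cliqueMap_single [DecidableEq (Clique Γ)] (σ : Clique Γ) :
    cliqueMap k Γ (Pi.single σ 1) = (extSRIdeal k (cliqueComplex Γ)).mkQ (extMonomial k σ.1) := by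
  rw [cliqueMap_apply, Finset.sum_eq_single σ (fun τ _ h => by simp [h]) (by simp)]
  simp

lemma mkQ_extMonomial_of_notMem {K : Set (Finset (Fin n))} {σ : Finset (Fin n)} (h : σ ∉ K) :
    (extSRIdeal k K).mkQ (extMonomial k σ) = 0 :=
  (Submodule.Quotient.mk_eq_zero _).2 (Submodule.subset_span ⟨σ, h, rfl⟩)

lemma cliqueMap_injective : Function.Injective (cliqueMap k Γ) := by
  rw [injective_iff_map_eq_zero]
  intro w hw
  rw [cliqueMap_apply, Submodule.mkQ_apply, Submodule.Quotient.mk_eq_zero] at hw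
  have h1 := (extBasis k n).mem_span_image.1 (extSRIdeal_le_span cliqueComplex_mono hw)
  funext σ
  by_contra h0
  refine h1 (?_ : σ.1 ∈ _) σ.2
  have h2 : (extBasis k n).repr (∑ τ : Clique Γ, w τ • extMonomial k τ.1) σ.1 = w σ := by
    rw [map_sum, Finset.sum_apply', Finset.sum_eq_single σ]
    · rw [map_smul, ← extBasis_apply, Module.Basis.repr_self]
      simp
    · intro τ _ hτ
      rw [map_smul, ← extBasis_apply, Module.Basis.repr_self, Finsupp.smul_apply,
        Finsupp.single_eq_of_ne fun h => hτ (Subtype.ext h.symm), smul_zero]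
    · simp
  exact Finsupp.mem_support_iff.2 (h2.trans_ne h0)

lemma cliqueMap_surjective : Function.Surjective (cliqueMap k Γ) := by
  intro y
  obtain ⟨x, rfl⟩ := Submodule.mkQ_surjective _ y
  change (extSRIdeal k (cliqueComplex Γ)).mkQ.restrictScalars k x ∈ LinearMap.range (cliqueMap k Γ)
  rw [← (extBasis k n).sum_repr x, map_sum]
  refine Submodule.sum_mem _ fun σ _ => ?_
  rw [map_smul, extBasis_apply]
  refine Submodule.smul_mem _ _ ?_
  by_cases h : σ ∈ cliqueComplex Γ
  · exact ⟨_, cliqueMap_single ⟨σ, h⟩⟩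
  · rw [LinearMap.restrictScalars_apply, mkQ_extMonomial_of_notMem h]
    exact zero_mem _

lemma incidence_eq_sum (j : Fin m) :
    incidence k Γ f j = ∑ i ∈ Finset.univ.filter (f · = j), incidence k Γ id i := by
  ext σ τ
  rw [Matrix.sum_apply, Finset.sum_filter]
  refine Finset.sum_congr rfl fun i _ => ?_
  refine Eq.trans ?_ (if_congr Iff.rfl (Fintype.sum_eq_single i fun l hl =>
    if_neg fun h => hl h.1).symm rfl)
  simp [ite_and]

lemma incidence_id_apply (i : Fin n) (σ τ : Clique Γ) : incidence k Γ id i σ τ =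
    if i ∈ σ.1 ∧ σ.1.erase i = τ.1 then (koszulSign i τ.1 : k) else 0 :=
  (Fintype.sum_eq_single i fun _ hl => if_neg fun h => hl h.1).trans (by simp)

lemma single_smul_cliqueMap (i : Fin n) (w : Clique Γ → k) :
    ExteriorAlgebra.ι k (Pi.single i 1 : Fin n → k) • cliqueMap k Γ w =
      cliqueMap k Γ ((incidence k Γ id i).mulVec w) := by
  have key : (DistribSMul.toLinearMap k _ (ExteriorAlgebra.ι k (Pi.single i 1 : Fin n → k))) ∘ₗ
      cliqueMap k Γ = cliqueMap k Γ ∘ₗ (incidence k Γ id i).mulVecLin := by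
    refine LinearMap.pi_ext' fun τ => LinearMap.ext_ring ?_
    simp only [LinearMap.comp_apply, LinearMap.single_apply, DistribSMul.toLinearMap_apply,
      Matrix.mulVecLin_apply, Matrix.mulVec_single_one]
    rw [cliqueMap_single, ← map_smul, smul_eq_mul, ι_mul_extMonomial, cliqueMap_apply]
    by_cases hi : i ∈ τ.1
    · rw [if_pos hi, map_zero, Finset.sum_eq_zero, map_zero]
      intro σ _
      rw [Matrix.col_apply, incidence_id_apply, if_neg, zero_smul]
      rintro ⟨-, h⟩
      exact Finset.notMem_erase i σ.1 (h ▸ hi)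
    · rw [if_neg hi]
      by_cases hK : insert i τ.1 ∈ cliqueComplex Γ
      · rw [Finset.sum_eq_single ⟨insert i τ.1, hK⟩]
        · rw [Matrix.col_apply, incidence_id_apply, if_pos ⟨Finset.mem_insert_self i _,
            Finset.erase_insert hi⟩]
        · intro σ _ hσ
          rw [Matrix.col_apply, incidence_id_apply, if_neg, zero_smul]
          rintro ⟨h1, h2⟩
          exact hσ (Subtype.ext (by simp only [← h2, Finset.insert_erase h1]))
        · simp
      · rw [LinearMap.map_smul_of_tower, mkQ_extMonomial_of_notMem hK, Finset.sum_eq_zero,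
          map_zero]
        · exact smul_zero (A := _ ⧸ extSRIdeal k (cliqueComplex Γ)) (koszulSign i τ.1 : k)
        intro σ _
        rw [Matrix.col_apply, incidence_id_apply, if_neg, zero_smul]
        rintro ⟨h1, h2⟩
        exact hK (by rw [← h2, Finset.insert_erase h1]; exact σ.2)
  exact LinearMap.congr_fun key w

lemma hGen_smul_cliqueMap (j : Fin m) (w : Clique Γ → k) :
    hGen k f j • cliqueMap k Γ w = cliqueMap k Γ ((incidence k Γ f j).mulVec w) := by
  rw [hGen, Finset.sum_smul, incidence_eq_sum, Matrix.sum_mulVec, map_sum]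
  exact Finset.sum_congr rfl fun i _ => single_smul_cliqueMap i w

lemma hGen_eq_ι (j : Fin m) : hGen k f j = ExteriorAlgebra.ι k
    (∑ i ∈ Finset.univ.filter (f · = j), Pi.single i 1) := by
  rw [map_sum, hGen]

lemma incidence_mulVec_mulVec {l : ℕ} {g : Fin n → Fin l} (i : Fin m) (j : Fin l)
    (w : Clique Γ → k) : (incidence k Γ f i).mulVec ((incidence k Γ g j).mulVec w) =
      -(incidence k Γ g j).mulVec ((incidence k Γ f i).mulVec w) := by
  refine cliqueMap_injective ?_
  rw [map_neg, ← hGen_smul_cliqueMap, ← hGen_smul_cliqueMap, ← hGen_smul_cliqueMap,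
    ← hGen_smul_cliqueMap, ← mul_smul, ← mul_smul, ← neg_smul, hGen_eq_ι, hGen_eq_ι,
    eq_neg_of_add_eq_zero_left (ExteriorAlgebra.ι_add_mul_swap _ _)]

variable (k Γ f) in
lemma isAnticommutingFamily_incidence : IsAnticommutingFamily k
    (fun l (σ : Clique Γ) => (σ.1.filter (f · = l)).card) (incidence k Γ f) where
  mul_self j := by
    refine Matrix.ext_of_mulVec_single fun τ => cliqueMap_injective ?_
    rw [← Matrix.mulVec_mulVec, ← hGen_smul_cliqueMap, ← hGen_smul_cliqueMap, ← mul_smul,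
      hGen_eq_ι, ExteriorAlgebra.ι_sq_zero, zero_smul, Matrix.zero_mulVec, map_zero]
  mul_eq_neg i j := by
    refine Matrix.ext_of_mulVec_single fun τ => ?_
    rw [Matrix.neg_mulVec, ← Matrix.mulVec_mulVec, ← Matrix.mulVec_mulVec, incidence_mulVec_mulVec]
  isHomogMatrix l j := by
    intro σ τ h
    obtain ⟨i, -, hi⟩ := Finset.exists_ne_zero_of_sum_ne_zero h
    obtain ⟨⟨rfl, h1, h2⟩, -⟩ := ite_ne_right_iff.1 hi
    have h5 : σ.1 = insert i τ.1 := by rw [← h2, Finset.insert_erase h1]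
    simp only [h5, Finset.filter_insert]
    have h3 : i ∉ τ.1 := h2 ▸ Finset.notMem_erase i σ.1
    by_cases h4 : f i = l
    · rw [if_pos h4, if_pos h4.symm, Finset.card_insert_of_notMem (by simp [h3])]
      push_cast
      rfl
    · rw [if_neg h4, if_neg (Ne.symm h4), add_zero]

lemma cliqueMap_mem_span_iff (i : Fin m) (w : Clique Γ → k) :
    cliqueMap k Γ w ∈ Submodule.span (ExteriorAlgebra k (Fin n → k))
      {x : _ ⧸ extSRIdeal k (cliqueComplex Γ) | ∃ j : Fin m, j < i ∧ ∃ y, x = hGen k f j • y} ↔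
      w ∈ IsAnticommutingFamily.imageSup (incidence k Γ f) i := by
  constructor
  · intro h
    suffices h' : ∀ x ∈ Submodule.span (ExteriorAlgebra k (Fin n → k))
        {x : _ ⧸ extSRIdeal k (cliqueComplex Γ) | ∃ j : Fin m, j < i ∧ ∃ y, x = hGen k f j • y},
        x ∈ (IsAnticommutingFamily.imageSup (incidence k Γ f) i).map (cliqueMap k Γ) by
      obtain ⟨v, hv, hvw⟩ := h' _ h
      exact cliqueMap_injective hvw ▸ hv
    intro x hx
    induction hx using Submodule.span_induction with
    | mem x hx =>
      obtain ⟨j, hj, y, rfl⟩ := hx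
      obtain ⟨v, rfl⟩ := cliqueMap_surjective y
      rw [hGen_smul_cliqueMap]
      exact Submodule.mem_map_of_mem (IsAnticommutingFamily.mulVec_mem_imageSup hj v)
    | zero => exact zero_mem _
    | add x y _ _ hx hy => exact add_mem hx hy
    | smul a x _ hx =>
      refine ExteriorAlgebra.smul_mem_of_forall_single (fun l y hy => ?_) a x hx
      obtain ⟨v, hv, rfl⟩ := hy
      rw [single_smul_cliqueMap]
      refine Submodule.mem_map_of_mem (IsAnticommutingFamily.map_mem_imageSup
        (g := (incidence k Γ id l).mulVecLin) (fun j hj z => ?_) v hv)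
      rw [Matrix.mulVecLin_apply, incidence_mulVec_mulVec, ← Matrix.mulVec_neg]
      exact IsAnticommutingFamily.mulVec_mem_imageSup hj _
  · intro h
    suffices h' : IsAnticommutingFamily.imageSup (incidence k Γ f) i ≤
        ((Submodule.span (ExteriorAlgebra k (Fin n → k))
        {x : _ ⧸ extSRIdeal k (cliqueComplex Γ) |
          ∃ j : Fin m, j < i ∧ ∃ y, x = hGen k f j • y}).restrictScalars k).comap
        (cliqueMap k Γ) from h' h
    refine iSup₂_le fun j hj => ?_
    rintro _ ⟨x, rfl⟩
    exact Submodule.subset_span ⟨j, hj, _, (hGen_smul_cliqueMap j x).symm⟩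

/-- Regularity of `h_i` modulo its predecessors, in the basis of exterior monomials of cliques. -/
lemma regular_srQuot_iff_exactMod (i : Fin m) :
    (∀ x : srQuot k (cliqueComplex Γ) f i,
        (hGen k f i • x = 0 ↔ ∃ y, x = hGen k f i • y)) ↔
      ExactMod k (incidence k Γ f i).mulVecLin
        (IsAnticommutingFamily.imageSup (incidence k Γ f) i) := by
  let N := Submodule.span (ExteriorAlgebra k (Fin n → k))
    {x : _ ⧸ extSRIdeal k (cliqueComplex Γ) | ∃ j : Fin m, j < i ∧ ∃ y, x = hGen k f j • y}
  let π : (_ ⧸ extSRIdeal k (cliqueComplex Γ)) →ₗ[ExteriorAlgebra k (Fin n → k)]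
    srQuot k (cliqueComplex Γ) f i := N.mkQ
  have hπ : ∀ w, π (cliqueMap k Γ w) = 0 ↔
      w ∈ IsAnticommutingFamily.imageSup (incidence k Γ f) i := fun w =>
    (Submodule.Quotient.mk_eq_zero N).trans (cliqueMap_mem_span_iff i w)
  have hsurj : Function.Surjective (fun w => π (cliqueMap k Γ w)) :=
    (Submodule.mkQ_surjective N).comp cliqueMap_surjective
  have hsmul : ∀ w, hGen k f i • π (cliqueMap k Γ w) =
      π (cliqueMap k Γ ((incidence k Γ f i).mulVec w)) := fun w => by
    rw [← map_smul, hGen_smul_cliqueMap]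
  have heq : ∀ v w, π (cliqueMap k Γ v) = hGen k f i • π (cliqueMap k Γ w) ↔
      v - (incidence k Γ f i).mulVec w ∈
        IsAnticommutingFamily.imageSup (incidence k Γ f) i := fun v w => by
    rw [hsmul, ← hπ, map_sub, map_sub, sub_eq_zero]
  constructor
  · intro h v hv
    obtain ⟨y, hy⟩ := (h (π (cliqueMap k Γ v))).1 ((hsmul v).trans ((hπ _).2 hv))
    obtain ⟨w, rfl⟩ := hsurj y
    exact ⟨w, (heq v w).1 hy⟩
  · intro h x
    constructor
    · obtain ⟨v, rfl⟩ := hsurj x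
      intro hv
      obtain ⟨w, hw⟩ := h v ((hπ _).1 ((hsmul v).symm.trans hv))
      exact ⟨_, (heq v w).2 hw⟩
    · rintro ⟨y, rfl⟩
      rw [← mul_smul, hGen_eq_ι, ExteriorAlgebra.ι_sq_zero, zero_smul]

end StanleyReisner

/-- For a field `k`, a graph `Γ` on `[n]` with clique
complex `K`, and a surjective `f : [n] → [m]`: the total group homology
`⊕_{q ≥ 0} H_q(G_Γ; k[ℤᵐ])` is finite-dimensional over `k` if and only if
`h₁, …, h_m` is a `k⟨K⟩`-regular sequence, i.e. for each `i` multiplication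
by `h_i` on `k⟨K⟩/(h₁,…,h_{i-1})k⟨K⟩` has kernel equal to image. -/
theorem total_groupHomology_finiteDimensional_iff_regular_sequence {n m : ℕ}
    (Γ : SimpleGraph (Fin n)) (f : Fin n → Fin m) (hf : Function.Surjective f)
    (φ : RAAG Γ →* Multiplicative (Fin m → ℤ))
    (hφ : ∀ i : Fin n, φ (PresentedGroup.of i) =
      Multiplicative.ofAdd (Pi.single (f i) 1)) :
    FiniteDimensional k (⨁ q : ℕ, groupHomologyLaurent k φ q) ↔
      (∀ i : Fin m, ∀ x : srQuot k (cliqueComplex Γ) f i,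
        (hGen k f i • x = 0 ↔ ∃ y, x = hGen k f i • y)) := by
  rw [finiteDimensional_directSum_iff k fun q => subsingleton_groupHomologyLaurent_of_lt k Γ φ,
    forall_finite_groupHomologyLaurent_iff k Γ f φ hφ,
    hasFiniteHomology_iff_exactMod (isAnticommutingFamily_incidence k Γ f)]
  exact forall_congr' fun i => (regular_srQuot_iff_exactMod i).symm
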